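/- arXiv:1804.01588 — 2 statements merged into one kernel-verified Lean document; each statement's English description precedes it below -/
import Mathlib

section
/- For every natural number d ≥ 1 there exists a constant C > 0 (depending only on d) with the following property. Let (X, dist) be a finite metric space with |X| ≥ 2 such that for every x ∈ X and every r > 0 the closed ball of radius 2r around x can be covered by at most 2^d closed balls of radius r (X has doubling dimension at most d). Then for every ε ∈ (0, 1) there exists an edge set S on X such that d_S(x, y) ≤ (1 + ε) · dist(x, y) for all x, y ∈ X and w(S) ≤ C · ε^{-(d+2)} · log(2 + ε⁻¹) · mstw(X). -/
open scoped ENNReal BigOperators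

universe u

/-- The distance function lifted to unordered pairs. -/
noncomputable def sym2Dist {X : Type u} [MetricSpace X] : Sym2 X → ℝ :=
  Sym2.lift ⟨fun x y => dist x y, fun _ _ => dist_comm _ _⟩

/-- The weight of an edge set: the sum of the distances of its pairs. -/
noncomputable def edgeWeight {X : Type u} [MetricSpace X] (E : Finset (Sym2 X)) : ℝ :=
  ∑ e ∈ E, sym2Dist e

/-- `E` is an edge set on `T`: a finite set of unordered pairs of distinct points of `T`. -/
def IsEdgeSetOn {X : Type u} (T : Finset X) (E : Finset (Sym2 X)) : Prop :=
  ∀ e ∈ E, ¬ e.IsDiag ∧ ∀ x ∈ e, x ∈ T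

/-- The length of the path starting at `p` and visiting the points of the list in order. -/
noncomputable def pathLength {X : Type u} [MetricSpace X] : X → List X → ℝ
  | _, [] => 0
  | p, x :: xs => dist p x + pathLength x xs

/-- `p :: l` is a path from `p` to `q` all of whose consecutive pairs are edges of `E`. -/
def IsPathIn {X : Type u} (E : Finset (Sym2 X)) (p q : X) (l : List X) : Prop :=
  List.Chain (fun a b => s(a, b) ∈ E) p l ∧ (p :: l).getLast (List.cons_ne_nil p l) = q

/-- The path-distance in the edge set `E`: the infimum in `[0, ∞]` of lengths of paths
in `E` from `p` to `q`. -/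
noncomputable def pathDist {X : Type u} [MetricSpace X] (E : Finset (Sym2 X)) (p q : X) :
    ℝ≥0∞ :=
  ⨅ (l : List X) (_ : IsPathIn E p q l), ENNReal.ofReal (pathLength p l)

/-- The minimum weight of an edge set on `T` connecting all points of `T` (MST weight). -/
noncomputable def mstw {X : Type u} [MetricSpace X] (T : Finset X) : ℝ :=
  sInf {w : ℝ | ∃ E : Finset (Sym2 X), IsEdgeSetOn T E ∧
    (∀ x ∈ T, ∀ y ∈ T, pathDist E x y < ⊤) ∧ w = edgeWeight E}

noncomputable section LightSpanner
open scoped Classical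

/-! ### Path distances -/

theorem IsPathIn.nil {X : Type u} (E : Finset (Sym2 X)) (p : X) : IsPathIn E p p [] := by
  exact ⟨List.IsChain.singleton p, rfl⟩

theorem IsPathIn.cons {X : Type u} {E : Finset (Sym2 X)} {p x q : X} {l : List X}
    (h : s(p, x) ∈ E) (hl : IsPathIn E x q l) : IsPathIn E p q (x :: l) := by
  obtain ⟨h1, h2⟩ := hl
  refine ⟨?_, ?_⟩
  · exact List.IsChain.cons_cons h h1
  · simpa using h2

theorem IsPathIn.cons_inv {X : Type u} {E : Finset (Sym2 X)} {p x q : X} {l : List X}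
    (h : IsPathIn E p q (x :: l)) : s(p, x) ∈ E ∧ IsPathIn E x q l := by
  obtain ⟨h1, h2⟩ := h
  have h1' : List.IsChain (fun a b => s(a, b) ∈ E) (p :: x :: l) := h1
  rw [List.isChain_cons_cons] at h1'
  refine ⟨h1'.1, h1'.2, ?_⟩
  simpa using h2

theorem IsPathIn.nil_inv {X : Type u} {E : Finset (Sym2 X)} {p q : X}
    (h : IsPathIn E p q []) : p = q := by
  simpa using h.2

theorem pathLength_nonneg {X : Type u} [MetricSpace X] (p : X) (l : List X) :
    0 ≤ pathLength p l := by
  induction l generalizing p with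
  | nil => simp [pathLength]
  | cons x l ih => simp only [pathLength]; exact add_nonneg dist_nonneg (ih x)

theorem pathDist_le {X : Type u} [MetricSpace X] {E : Finset (Sym2 X)} {p q : X} {l : List X}
    (h : IsPathIn E p q l) : pathDist E p q ≤ ENNReal.ofReal (pathLength p l) :=
  iInf₂_le l h

theorem pathDist_self {X : Type u} [MetricSpace X] (E : Finset (Sym2 X)) (p : X) :
    pathDist E p p = 0 := by
  have := pathDist_le (IsPathIn.nil E p)
  simpa [pathLength] using this

theorem pathDist_edge {X : Type u} [MetricSpace X] {E : Finset (Sym2 X)} {p q : X}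
    (h : s(p, q) ∈ E) : pathDist E p q ≤ ENNReal.ofReal (dist p q) := by
  have := pathDist_le (IsPathIn.cons h (IsPathIn.nil E q))
  simpa [pathLength] using this

theorem pathDist_triangle {X : Type u} [MetricSpace X] (E : Finset (Sym2 X)) (p q s : X) :
    pathDist E p s ≤ pathDist E p q + pathDist E q s := by
  have key : ∀ (l : List X) (p : X), IsPathIn E p q l →
      pathDist E p s ≤ ENNReal.ofReal (pathLength p l) + pathDist E q s := by
    intro l
    induction l with
    | nil =>
      intro p h
      rw [h.nil_inv]; simp
    | cons x l ih =>
      intro p h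
      obtain ⟨h1, h2⟩ := h.cons_inv
      have ih' := ih x h2
      have step : pathDist E p s ≤ ENNReal.ofReal (dist p x) + pathDist E x s := by
        conv_rhs => rw [pathDist]
        simp only [ENNReal.add_iInf]
        refine le_iInf₂ fun l' hl' => ?_
        refine (pathDist_le (IsPathIn.cons h1 hl')).trans ?_
        rw [pathLength, ENNReal.ofReal_add dist_nonneg (pathLength_nonneg _ _)]
      refine step.trans ?_
      rw [pathLength, ENNReal.ofReal_add dist_nonneg (pathLength_nonneg _ _), add_assoc]
      gcongr
  conv_rhs => rw [pathDist]
  simp only [ENNReal.iInf_add]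
  exact le_iInf₂ fun l hl => key l p hl

theorem pathDist_symm_le {X : Type u} [MetricSpace X] (E : Finset (Sym2 X)) (p q : X) :
    pathDist E q p ≤ pathDist E p q := by
  have key : ∀ (l : List X) (p : X), IsPathIn E p q l →
      pathDist E q p ≤ ENNReal.ofReal (pathLength p l) := by
    intro l
    induction l with
    | nil =>
      intro p h
      rw [h.nil_inv, pathDist_self]; simp
    | cons x l ih =>
      intro p h
      obtain ⟨h1, h2⟩ := h.cons_inv
      have ih' := ih x h2
      refine (pathDist_triangle E q x p).trans ?_
      rw [pathLength, ENNReal.ofReal_add dist_nonneg (pathLength_nonneg _ _), add_comm]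
      have h1' : s(x, p) ∈ E := by rwa [Sym2.eq_swap]
      have := pathDist_edge h1'
      rw [dist_comm] at this
      exact add_le_add this ih'
  conv_rhs => rw [pathDist]
  exact le_iInf₂ fun l hl => key l p hl

theorem pathDist_mono {X : Type u} [MetricSpace X] {E E' : Finset (Sym2 X)} (h : E ⊆ E')
    (p q : X) : pathDist E' p q ≤ pathDist E p q := by
  have key : ∀ (l : List X) (p : X), IsPathIn E p q l → IsPathIn E' p q l := by
    intro l
    induction l with
    | nil =>
      intro p h
      rw [h.nil_inv]; exact IsPathIn.nil _ _
    | cons x l ih =>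
      intro p hp
      obtain ⟨h1, h2⟩ := hp.cons_inv
      exact IsPathIn.cons (h h1) (ih x h2)
  conv_rhs => rw [pathDist]
  exact le_iInf₂ fun l hl => pathDist_le (key l p hl)

theorem dist_le_pathDist {X : Type u} [MetricSpace X] (E : Finset (Sym2 X)) (p q : X) :
    ENNReal.ofReal (dist p q) ≤ pathDist E p q := by
  have key : ∀ (l : List X) (p : X), IsPathIn E p q l → dist p q ≤ pathLength p l := by
    intro l
    induction l with
    | nil =>
      intro p h
      rw [h.nil_inv]; simp [pathLength]
    | cons x l ih =>
      intro p hp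
      obtain ⟨h1, h2⟩ := hp.cons_inv
      have := ih x h2
      have := dist_triangle p x q
      simp only [pathLength]; linarith
  exact le_iInf₂ fun l hl => ENNReal.ofReal_le_ofReal (key l p hl)

/-- Pseudo-metrics dominating the ambient distance. -/
structure IsPM {X : Type u} [MetricSpace X] (ρ : X → X → ℝ) : Prop where
  dist_le : ∀ x y, dist x y ≤ ρ x y
  self : ∀ x, ρ x x = 0
  symm : ∀ x y, ρ x y = ρ y x
  tri : ∀ x y z, ρ x z ≤ ρ x y + ρ y z

/-- Edge sets connecting everything. -/
def Conn {X : Type u} [MetricSpace X] (E : Finset (Sym2 X)) : Prop :=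
  ∀ x y, pathDist E x y < ⊤

/-- Real-valued path distance. -/
def pd {X : Type u} [MetricSpace X] (E : Finset (Sym2 X)) (x y : X) : ℝ :=
  (pathDist E x y).toReal

theorem Conn.mono {X : Type u} [MetricSpace X] {E E' : Finset (Sym2 X)} (h : Conn E)
    (hs : E ⊆ E') : Conn E' := fun x y => (pathDist_mono hs x y).trans_lt (h x y)

theorem Conn.isPM {X : Type u} [MetricSpace X] {E : Finset (Sym2 X)} (h : Conn E) :
    IsPM (pd E) where
  dist_le x y := by
    rw [pd, ← ENNReal.ofReal_le_iff_le_toReal (h x y).ne]; exact dist_le_pathDist E x y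
  self x := by simp [pd, pathDist_self]
  symm x y := by
    rw [pd, pd, le_antisymm (pathDist_symm_le E y x) (pathDist_symm_le E x y)]
  tri x y z := by
    rw [pd, pd, pd, ← ENNReal.toReal_add (h x y).ne (h y z).ne]
    exact ENNReal.toReal_mono (ENNReal.add_lt_top.2 ⟨h x y, h y z⟩).ne (pathDist_triangle E x y z)

theorem Conn.pd_mono {X : Type u} [MetricSpace X] {E E' : Finset (Sym2 X)} (h : Conn E)
    (hs : E ⊆ E') (x y : X) : pd E' x y ≤ pd E x y :=
  ENNReal.toReal_mono (h x y).ne (pathDist_mono hs x y)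

theorem pd_edge {X : Type u} [MetricSpace X] {E : Finset (Sym2 X)} {x y : X}
    (he : s(x, y) ∈ E) : pd E x y ≤ dist x y := by
  have := ENNReal.toReal_mono (by simp) (pathDist_edge he)
  rwa [ENNReal.toReal_ofReal dist_nonneg] at this

theorem Conn.pathDist_le_of_pd {X : Type u} [MetricSpace X] {E : Finset (Sym2 X)} (h : Conn E)
    {x y : X} {c : ℝ} (hc : pd E x y ≤ c) : pathDist E x y ≤ ENNReal.ofReal c := by
  rw [← ENNReal.ofReal_toReal (h x y).ne]
  exact ENNReal.ofReal_le_ofReal hc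

/-! ### Packing -/

/-- The doubling hypothesis. -/
def Doubling (X : Type u) [MetricSpace X] (d : ℕ) : Prop :=
  ∀ (x : X) (r : ℝ), 0 < r →
          ∃ F : Finset X, F.card ≤ 2 ^ d ∧
            Metric.closedBall x (2 * r) ⊆ ⋃ y ∈ (F : Set X), Metric.closedBall y r

theorem packing {X : Type u} [MetricSpace X] {d : ℕ} (hD : Doubling X d) {s : ℝ} (hs : 0 < s)
    (k : ℕ) : ∀ (x : X) (Q : Finset X), (∀ p ∈ Q, dist p x ≤ 2 ^ k * s) →
      (∀ p ∈ Q, ∀ q ∈ Q, p ≠ q → 2 * s < dist p q) → Q.card ≤ 2 ^ (k * d) := by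
  induction k with
  | zero =>
    intro x Q h1 h2
    simp only [zero_mul, pow_zero]
    rw [Finset.card_le_one]
    intro a ha b hb
    by_contra hab
    have := h2 a ha b hb hab
    have h3 := h1 a ha
    have h4 := h1 b hb
    have := dist_triangle_right a b x
    simp at h3 h4
    linarith
  | succ k ih =>
    intro x Q h1 h2
    obtain ⟨F, hF, hcov⟩ := hD x (2 ^ k * s) (by positivity)
    have hex : ∀ p ∈ Q, ∃ y ∈ F, dist p y ≤ 2 ^ k * s := by
      intro p hp
      have : p ∈ Metric.closedBall x (2 * (2 ^ k * s)) := by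
        rw [Metric.mem_closedBall]; have := h1 p hp; rw [pow_succ] at this; linarith
      have := hcov this
      simpa [Set.mem_iUnion] using this
    choose! g hg1 hg2 using hex
    have := Finset.card_le_mul_card_image_of_maps_to (s := Q) (t := F) (f := g) hg1 (2 ^ (k * d))
      (by
        intro y hy
        apply ih y
        · intro p hp
          rw [Finset.mem_filter] at hp
          have := hg2 p hp.1
          rwa [hp.2] at this
        · intro p hp q hq
          exact h2 p (Finset.mem_filter.1 hp).1 q (Finset.mem_filter.1 hq).1)
    refine this.trans ?_
    calc 2 ^ (k * d) * F.card ≤ 2 ^ (k * d) * 2 ^ d := Nat.mul_le_mul_left _ hF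
      _ = 2 ^ ((k + 1) * d) := by rw [← pow_add]; ring_nf

/-- Existence of nets. -/
theorem exists_net {X : Type u} [MetricSpace X] [Fintype X] {τ : ℝ} (hτ : 0 ≤ τ) :
    ∃ N : Finset X, (∀ p ∈ N, ∀ q ∈ N, p ≠ q → τ < dist p q) ∧
      ∀ x, ∃ p ∈ N, dist x p ≤ τ := by
  obtain ⟨N, hN⟩ := (Set.toFinite {N : Finset X | ∀ p ∈ N, ∀ q ∈ N, p ≠ q → τ < dist p q}).exists_maximal
    ⟨∅, by simp⟩
  refine ⟨N, hN.1, fun x => ?_⟩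
  by_contra hx
  push Not at hx
  have hins : insert x N ∈ {N : Finset X | ∀ p ∈ N, ∀ q ∈ N, p ≠ q → τ < dist p q} := by
    intro p hp q hq hpq
    rw [Finset.mem_insert] at hp hq
    rcases hp with rfl | hp <;> rcases hq with rfl | hq
    · exact absurd rfl hpq
    · exact hx q hq
    · rw [dist_comm]; exact hx p hp
    · exact hN.1 p hp q hq hpq
  have hmem := hN.2 hins (Finset.subset_insert x N) (Finset.mem_insert_self x N)
  have := hx x hmem
  simp at this
  linarith

end LightSpanner

noncomputable section LightSpanner
open scoped Classical
set_option linter.unusedSectionVars false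

/-! ### Rooted trees given by parent maps -/

structure IsTree {X : Type u} (V : Finset X) (r : X) (par : X → X) : Prop where
  root_mem : r ∈ V
  par_root : par r = r
  par_mem : ∀ v ∈ V, par v ∈ V
  reach : ∀ v ∈ V, ∃ n : ℕ, par^[n] v = r

namespace IsTree
variable {X : Type u} {V : Finset X} {r : X} {par : X → X}

theorem iter_mem (h : IsTree V r par) {v : X} (hv : v ∈ V) (n : ℕ) : par^[n] v ∈ V := by
  induction n with
  | zero => exact hv
  | succ n ih => rw [Function.iterate_succ_apply']; exact h.par_mem _ ih

theorem iter_root (h : IsTree V r par) (n : ℕ) : par^[n] r = r :=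
  Function.iterate_fixed h.par_root n

theorem no_cycle (h : IsTree V r par) {v : X} (hv : v ∈ V) {n : ℕ} (hn : 0 < n)
    (hc : par^[n] v = v) : v = r := by
  obtain ⟨m, hm⟩ := h.reach v hv
  have h1 : par^[n * m] v = v := (Function.IsPeriodicPt.mul_const (m := n) (f := par) (x := v) hc m)
  have h2 : m ≤ n * m := Nat.le_mul_of_pos_left m hn
  rw [← Nat.sub_add_cancel h2, Function.iterate_add_apply, hm, h.iter_root] at h1
  exact h1.symm

theorem par_ne (h : IsTree V r par) {v : X} (hv : v ∈ V) (hr : v ≠ r) : par v ≠ v :=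
  fun hc => hr (h.no_cycle hv (n := 1) one_pos hc)

theorem exists_bound (h : IsTree V r par) : ∃ M : ℕ, ∀ v ∈ V, par^[M] v = r := by
  choose! n hn using h.reach
  refine ⟨V.sup n, fun v hv => ?_⟩
  have h2 : n v ≤ V.sup n := Finset.le_sup hv
  rw [← Nat.sub_add_cancel h2, Function.iterate_add_apply, hn v hv, h.iter_root]

theorem reparent (h : IsTree V r par) {a b : X} {D : Finset X} (har : a ≠ r)
    (hb : b ∈ V) (hrD : r ∉ D) (hbD : b ∉ D)
    (hD : ∀ v ∈ V, par v ∈ D → v ∈ D ∨ v = a) (hba : ∀ n : ℕ, par^[n] b ≠ a) :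
    IsTree (V \ D) r (Function.update par a b) := by
  have hbn : ∀ n : ℕ, par^[n] b ∉ D ∧ (Function.update par a b)^[n] b = par^[n] b := by
    intro n
    induction n with
    | zero => exact ⟨hbD, rfl⟩
    | succ n ih =>
      rw [Function.iterate_succ_apply', Function.iterate_succ_apply', ih.2,
        Function.update_of_ne (hba n)]
      refine ⟨fun hc => ?_, rfl⟩
      rcases hD _ (h.iter_mem hb n) hc with h1 | h1
      · exact ih.1 h1
      · exact hba n h1
  refine ⟨?_, ?_, ?_, ?_⟩
  · simp [h.root_mem, hrD]
  · rw [Function.update_of_ne har.symm, h.par_root]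
  · intro v hv
    rw [Finset.mem_sdiff] at hv ⊢
    by_cases hva : v = a
    · subst hva; simp [hb, hbD]
    · rw [Function.update_of_ne hva]
      refine ⟨h.par_mem v hv.1, fun hc => ?_⟩
      rcases hD v hv.1 hc with h1 | h1
      · exact hv.2 h1
      · exact hva h1
  · have key : ∀ (n : ℕ) (v : X), v ∈ V → v ∉ D → par^[n] v = r →
        ∃ m : ℕ, (Function.update par a b)^[m] v = r := by
      intro n
      induction n with
      | zero => intro v _ _ hn; exact ⟨0, hn⟩
      | succ n ih =>
        intro v hv hvD hn
        by_cases hva : v = a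
        · obtain ⟨m, hm⟩ := h.reach b hb
          refine ⟨m + 1, ?_⟩
          rw [Function.iterate_succ_apply, hva, Function.update_self, (hbn m).2, hm]
        · rw [Function.iterate_succ_apply] at hn
          have hpD : par v ∉ D := fun hc => by
            rcases hD v hv hc with h1 | h1
            · exact hvD h1
            · exact hva h1
          obtain ⟨m, hm⟩ := ih (par v) (h.par_mem v hv) hpD hn
          refine ⟨m + 1, ?_⟩
          rw [Function.iterate_succ_apply, Function.update_of_ne hva, hm]
    intro v hv
    rw [Finset.mem_sdiff] at hv
    obtain ⟨n, hn⟩ := h.reach v hv.1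
    exact key n v hv.1 hv.2 hn

end IsTree

/-- Skeletons: rooted trees with edge weights dominating `ρ` and a set `Λ` of trimmed leaves. -/
structure IsSkel {X : Type u} (ρ : X → X → ℝ) (V : Finset X) (r : X) (par : X → X)
    (ω : X → ℝ) (Λ : Finset X) : Prop extends IsTree V r par where
  ω_root : ω r = 0
  ω_ge : ∀ v ∈ V, ρ v (par v) ≤ ω v
  Λ_sub : Λ ⊆ V
  Λ_leaf : ∀ v ∈ V, par v ∉ Λ

/-- Effective weight. -/
def eff {X : Type u} (ω : X → ℝ) (Λ : Finset X) (T : ℝ) (v : X) : ℝ :=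
  if v ∈ Λ then max (ω v - T) 0 else ω v

/-- Potential. -/
def Phi {X : Type u} (V : Finset X) (ω : X → ℝ) (Λ : Finset X) (T : ℝ) : ℝ :=
  ∑ v ∈ V, eff ω Λ T v

/-- Weighted depth functions. -/
structure IsDep {X : Type u} (V : Finset X) (r : X) (par : X → X) (ω dep : X → ℝ) : Prop where
  root : dep r = 0
  step : ∀ v ∈ V, dep v = dep (par v) + ω v

theorem IsSkel.exists_dep {X : Type u} {ρ : X → X → ℝ} {V : Finset X} {r : X} {par : X → X}
    {ω : X → ℝ} {Λ : Finset X} (h : IsSkel ρ V r par ω Λ) : ∃ dep, IsDep V r par ω dep := by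
  obtain ⟨M, hM⟩ := h.exists_bound
  refine ⟨fun v => ∑ j ∈ Finset.range M, ω (par^[j] v), ?_, ?_⟩
  · apply Finset.sum_eq_zero
    intro j _
    rw [h.iter_root, h.ω_root]
  · intro v hv
    have h1 := Finset.sum_range_succ (fun j => ω (par^[j] v)) M
    have h2 := Finset.sum_range_succ' (fun j => ω (par^[j] v)) M
    simp only [Function.iterate_zero, id, Function.iterate_succ_apply] at h2
    rw [hM v hv, h.ω_root] at h1
    linarith

namespace IsSkel
variable {X : Type u} [MetricSpace X] {ρ : X → X → ℝ} {V : Finset X} {r : X} {par : X → X}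
    {ω : X → ℝ} {Λ : Finset X} {dep : X → ℝ}

theorem ω_nonneg (h : IsSkel ρ V r par ω Λ) (hρ : IsPM ρ) {v : X} (hv : v ∈ V) : 0 ≤ ω v :=
  (dist_nonneg.trans (hρ.dist_le _ _)).trans (h.ω_ge v hv)

theorem ω_pos (h : IsSkel ρ V r par ω Λ) (hρ : IsPM ρ) {v : X} (hv : v ∈ V) (hr : v ≠ r) :
    0 < ω v :=
  ((dist_pos.2 (h.par_ne hv hr).symm).trans_le (hρ.dist_le _ _)).trans_le (h.ω_ge v hv)

theorem eff_nonneg (h : IsSkel ρ V r par ω Λ) (hρ : IsPM ρ) {v : X} (hv : v ∈ V) (T : ℝ) :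
    0 ≤ eff ω Λ T v := by
  unfold eff; split_ifs
  · exact le_max_right _ _
  · exact h.ω_nonneg hρ hv

theorem eff_ge (T : ℝ) (hT : 0 ≤ T) (v : X) : ω v - T ≤ eff ω Λ T v := by
  unfold eff; split_ifs
  · exact le_max_left _ _
  · linarith

theorem Phi_anti (V : Finset X) (ω : X → ℝ) (Λ : Finset X) {T T' : ℝ} (hT : T ≤ T') :
    Phi V ω Λ T' ≤ Phi V ω Λ T := by
  apply Finset.sum_le_sum
  intro v _
  unfold eff; split_ifs
  · exact max_le_max (by linarith) le_rfl
  · exact le_rfl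

theorem Phi_nonneg (h : IsSkel ρ V r par ω Λ) (hρ : IsPM ρ) (T : ℝ) : 0 ≤ Phi V ω Λ T :=
  Finset.sum_nonneg fun _ hv => h.eff_nonneg hρ hv T

theorem root_notMem (h : IsSkel ρ V r par ω Λ) : r ∉ Λ := by
  have := h.Λ_leaf r h.root_mem
  rwa [h.par_root] at this

theorem dep_sum (h : IsSkel ρ V r par ω Λ) (hd : IsDep V r par ω dep) {v : X} (hv : v ∈ V)
    (k : ℕ) : ∑ j ∈ Finset.range k, ω (par^[j] v) = dep v - dep (par^[k] v) := by
  induction k with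
  | zero => simp
  | succ k ih =>
    rw [Finset.sum_range_succ, ih, hd.step _ (h.iter_mem hv k), Function.iterate_succ_apply']
    ring

theorem dep_anti (h : IsSkel ρ V r par ω Λ) (hρ : IsPM ρ) (hd : IsDep V r par ω dep) {v : X}
    (hv : v ∈ V) (k : ℕ) : dep (par^[k] v) ≤ dep v := by
  have := h.dep_sum hd hv k
  have h2 : 0 ≤ ∑ j ∈ Finset.range k, ω (par^[j] v) :=
    Finset.sum_nonneg fun j _ => h.ω_nonneg hρ (h.iter_mem hv j)
  linarith

theorem dep_anti' (h : IsSkel ρ V r par ω Λ) (hρ : IsPM ρ) (hd : IsDep V r par ω dep) {v : X}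
    (hv : v ∈ V) {j k : ℕ} (hjk : j ≤ k) : dep (par^[k] v) ≤ dep (par^[j] v) := by
  rw [← Nat.sub_add_cancel hjk, Function.iterate_add_apply]
  exact h.dep_anti hρ hd (h.iter_mem hv j) _

theorem dep_nonneg (h : IsSkel ρ V r par ω Λ) (hρ : IsPM ρ) (hd : IsDep V r par ω dep) {v : X}
    (hv : v ∈ V) : 0 ≤ dep v := by
  obtain ⟨n, hn⟩ := h.reach v hv
  have := h.dep_anti hρ hd hv n
  rwa [hn, hd.root] at this

theorem ρ_le (h : IsSkel ρ V r par ω Λ) (hρ : IsPM ρ) (hd : IsDep V r par ω dep) {v : X}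
    (hv : v ∈ V) (k : ℕ) : ρ v (par^[k] v) ≤ dep v - dep (par^[k] v) := by
  induction k with
  | zero => simp [hρ.self]
  | succ k ih =>
    have h1 := hρ.tri v (par^[k] v) (par^[k + 1] v)
    rw [Function.iterate_succ_apply'] at h1 ⊢
    have h2 := h.ω_ge _ (h.iter_mem hv k)
    have h3 := hd.step _ (h.iter_mem hv k)
    linarith

/-- Iterates before reaching the root are distinct. -/
theorem injOn (h : IsSkel ρ V r par ω Λ) {v : X} (hv : v ∈ V) {k : ℕ}
    (hk : ∀ j < k, par^[j] v ≠ r) :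
    Set.InjOn (fun j => par^[j] v) (Finset.range k : Set ℕ) := by
  have key : ∀ i j : ℕ, i < j → j < k → par^[i] v ≠ par^[j] v := by
    intro i j hij hjk heq
    rw [← Nat.sub_add_cancel hij.le, Function.iterate_add_apply] at heq
    exact hk i (hij.trans hjk) (h.no_cycle (h.iter_mem hv i) (by omega) heq.symm)
  intro i hi j hj hij
  simp only [Finset.coe_range, Set.mem_Iio] at hi hj
  rcases lt_trichotomy i j with h1 | h1 | h1
  · exact absurd hij (key i j h1 hj)
  · exact h1
  · exact absurd hij.symm (key j i h1 hi)

theorem sum_path_eff (h : IsSkel ρ V r par ω Λ) (hd : IsDep V r par ω dep) {v : X} (hv : v ∈ V)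
    {T : ℝ} (hT : 0 ≤ T) (k : ℕ) :
    dep v - dep (par^[k] v) - T ≤ ∑ j ∈ Finset.range k, eff ω Λ T (par^[j] v) := by
  rw [← h.dep_sum hd hv k]
  rcases k with _ | k
  · simp [hT]
  · rw [Finset.sum_range_succ', Finset.sum_range_succ']
    have h1 : ∀ j ∈ Finset.range k, ω (par^[j + 1] v) = eff ω Λ T (par^[j + 1] v) := by
      intro j _
      rw [eff, if_neg]
      rw [Function.iterate_succ_apply']
      exact h.Λ_leaf _ (h.iter_mem hv j)
    rw [Finset.sum_congr rfl h1]
    have := eff_ge (ω := ω) (Λ := Λ) T hT (par^[0] v)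
    linarith

/-- Effective weight of any set containing an ancestor path. -/
theorem sum_path_le (h : IsSkel ρ V r par ω Λ) (hρ : IsPM ρ) (hd : IsDep V r par ω dep) {v : X}
    (hv : v ∈ V) {T : ℝ} (hT : 0 ≤ T) {k : ℕ} (hk : ∀ j < k, par^[j] v ≠ r) {B : Finset X}
    (hB : B ⊆ V) (hBk : ∀ j < k, par^[j] v ∈ B) :
    dep v - dep (par^[k] v) - T ≤ ∑ u ∈ B, eff ω Λ T u := by
  refine (h.sum_path_eff hd hv hT k).trans ?_
  rw [← Finset.sum_image (f := eff ω Λ T) (g := fun j => par^[j] v) (h.injOn hv hk)]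
  apply Finset.sum_le_sum_of_subset_of_nonneg
  · intro u hu
    obtain ⟨j, hj, rfl⟩ := Finset.mem_image.1 hu
    exact hBk j (Finset.mem_range.1 hj)
  · intro u hu _
    exact h.eff_nonneg hρ (hB hu) T

end IsSkel
end LightSpanner

noncomputable section LightSpanner
open scoped Classical
set_option linter.unusedSectionVars false

/-! ### Pruning -/

/-- Vertices surviving the pruning. -/
def prune {X : Type u} (V : Finset X) (r : X) (par : X → X) (dep : X → ℝ) (R : ℝ) : Finset X :=
  V.filter fun v => v = r ∨ ∃ x ∈ V, ∃ n : ℕ, par^[n] x = v ∧ R < dep x - dep (par v)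

/-- Non-root leaves. -/
def leaves {X : Type u} (V : Finset X) (r : X) (par : X → X) : Finset X :=
  V.filter fun v => v ≠ r ∧ ∀ u ∈ V, par u ≠ v

/-- Tops of chains. -/
def tops {X : Type u} (V : Finset X) (r : X) (par : X → X) : Finset X :=
  (V.erase r).filter fun c => par c = r ∨ ∃ c' ∈ V, c' ≠ c ∧ par c' = par c

theorem prune_sub {X : Type u} (V : Finset X) (r : X) (par : X → X) (dep : X → ℝ) (R : ℝ) :
    prune V r par dep R ⊆ V := Finset.filter_subset _ _

theorem leaves_sub {X : Type u} (V : Finset X) (r : X) (par : X → X) :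
    leaves V r par ⊆ V := Finset.filter_subset _ _

namespace IsTree
variable {X : Type u} {V : Finset X} {r : X} {par : X → X}

theorem tops_card (h : IsTree V r par) : (tops V r par).card ≤ 2 * (leaves V r par).card := by
  set k : X → ℕ := fun b => ((V.erase r).filter (fun v => par v = b)).card with hk
  set t : X → ℕ := fun b => ((tops V r par).filter (fun v => par v = b)).card with ht
  have h1 : (V.erase r).card = ∑ b ∈ V, k b :=
    Finset.card_eq_sum_card_fiberwise fun v hv => h.par_mem v (Finset.mem_of_mem_erase hv)
  have h2 : (tops V r par).card = ∑ b ∈ V, t b := by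
    refine Finset.card_eq_sum_card_fiberwise fun v hv => h.par_mem v ?_
    exact Finset.mem_of_mem_erase (Finset.mem_filter.1 hv).1
  have h3 : ∀ b ∈ V, (t b : ℤ) ≤ 2 * ((k b : ℤ) - 1) + 2 * (if b = r then 1 else 0) +
      2 * (if b ∈ leaves V r par then 1 else 0) := by
    intro b hb
    have htk : t b ≤ k b := Finset.card_le_card (by
      intro v hv
      rw [Finset.mem_filter] at hv ⊢
      exact ⟨(Finset.mem_filter.1 hv.1).1, hv.2⟩)
    by_cases hbr : b = r
    · rw [if_pos hbr]
      split_ifs <;> omega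
    · rw [if_neg hbr]
      rcases Nat.lt_or_ge (k b) 2 with hk2 | hk2
      · have ht0 : t b = 0 := by
          by_contra hne
          obtain ⟨c, hc⟩ := Finset.card_pos.1 (Nat.pos_of_ne_zero hne)
          rw [Finset.mem_filter] at hc
          obtain ⟨hc1, hc2⟩ := hc
          rw [tops, Finset.mem_filter] at hc1
          obtain ⟨hc3, hc4⟩ := hc1
          rcases hc4 with hc4 | ⟨c', hc', hne', hpar⟩
          · exact hbr (hc2 ▸ hc4)
          · have : 1 < k b := by
              rw [hk, Finset.one_lt_card]
              refine ⟨c, Finset.mem_filter.2 ⟨hc3, hc2⟩, c', Finset.mem_filter.2 ⟨?_, ?_⟩, hne'.symm⟩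
              · refine Finset.mem_erase.2 ⟨?_, hc'⟩
                rintro rfl
                rw [h.par_root] at hpar
                exact hbr (by rw [← hc2, ← hpar])
              · rw [hpar, hc2]
            omega
        rw [ht0]
        rcases Nat.eq_zero_or_pos (k b) with hk0 | hk0
        · have : b ∈ leaves V r par := by
            refine Finset.mem_filter.2 ⟨hb, hbr, ?_⟩
            intro u hu hub
            have : u ∈ (V.erase r).filter (fun v => par v = b) := by
              refine Finset.mem_filter.2 ⟨Finset.mem_erase.2 ⟨?_, hu⟩, hub⟩
              rintro rfl
              rw [h.par_root] at hub; exact hbr hub.symm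
            rw [Finset.card_eq_zero] at hk0
            rw [hk0] at this
            simp at this
          rw [if_pos this, hk0]; norm_num
        · split_ifs <;> omega
      · split_ifs <;> omega
  have h4 := Finset.sum_le_sum h3
  rw [Finset.sum_add_distrib, Finset.sum_add_distrib, ← Finset.mul_sum, ← Finset.mul_sum,
    ← Finset.mul_sum, Finset.sum_sub_distrib] at h4
  rw [Finset.sum_ite_eq' V r, if_pos h.root_mem] at h4
  have h5 : ∑ b ∈ V, (if b ∈ leaves V r par then (1 : ℤ) else 0) = (leaves V r par).card := by
    rw [Finset.sum_ite_mem, Finset.inter_eq_right.2 (leaves_sub V r par)]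
    simp
  rw [h5] at h4
  have h6 : (V.erase r).card + 1 = V.card := Finset.card_erase_add_one h.root_mem
  have h7 : ∑ b ∈ V, (k b : ℤ) = (V.erase r).card := by rw [h1]; push_cast; rfl
  have h8 : ∑ b ∈ V, (t b : ℤ) = (tops V r par).card := by rw [h2]; push_cast; rfl
  rw [h7, h8] at h4
  simp only [Finset.sum_const, nsmul_eq_mul, mul_one] at h4
  omega

end IsTree

namespace IsSkel
variable {X : Type u} [MetricSpace X] {ρ : X → X → ℝ} {V : Finset X} {r : X} {par : X → X}
    {ω : X → ℝ} {Λ : Finset X} {dep : X → ℝ} {R T : ℝ}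

theorem prune_not {v : X} (hv : v ∈ V) (hn : v ∉ prune V r par dep R) {x : X} (hx : x ∈ V)
    {n : ℕ} (hxn : par^[n] x = v) : dep x - dep (par v) ≤ R := by
  by_contra hc
  push Not at hc
  exact hn (Finset.mem_filter.2 ⟨hv, Or.inr ⟨x, hx, n, hxn, hc⟩⟩)

theorem prune_skel (h : IsSkel ρ V r par ω Λ) (hρ : IsPM ρ) (hd : IsDep V r par ω dep) (R : ℝ) :
    IsSkel ρ (prune V r par dep R) r par ω (leaves (prune V r par dep R) r par) := by
  have hroot : r ∈ prune V r par dep R := Finset.mem_filter.2 ⟨h.root_mem, Or.inl rfl⟩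
  refine ⟨⟨hroot, h.par_root, ?_, ?_⟩, h.ω_root, ?_, leaves_sub _ _ _, ?_⟩
  · intro v hv
    obtain ⟨hv1, hv2⟩ := Finset.mem_filter.1 hv
    rcases hv2 with rfl | ⟨x, hx, n, hxn, hR⟩
    · rwa [h.par_root]
    · refine Finset.mem_filter.2 ⟨h.par_mem v hv1, Or.inr ⟨x, hx, n + 1, ?_, ?_⟩⟩
      · rw [Function.iterate_succ_apply', hxn]
      · have := h.dep_anti hρ hd (h.par_mem v hv1) 1
        simp only [Function.iterate_one] at this
        linarith
  · intro v hv; exact h.reach v (prune_sub _ _ _ _ _ hv)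
  · intro v hv; exact h.ω_ge v (prune_sub _ _ _ _ _ hv)
  · intro v hv hc
    exact (Finset.mem_filter.1 hc).2.2 v hv rfl

theorem prune_cover (h : IsSkel ρ V r par ω Λ) (hR : 0 ≤ R)
    {v : X} (hv : v ∈ V) :
    ∃ n : ℕ, par^[n] v ∈ prune V r par dep R ∧ dep v - dep (par^[n] v) ≤ R := by
  have hex : ∃ n : ℕ, par^[n] v ∈ prune V r par dep R := by
    obtain ⟨n, hn⟩ := h.reach v hv
    exact ⟨n, by rw [hn]; exact Finset.mem_filter.2 ⟨h.root_mem, Or.inl rfl⟩⟩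
  refine ⟨Nat.find hex, Nat.find_spec hex, ?_⟩
  rcases hm : Nat.find hex with _ | m
  · simpa using hR
  · have hlt : m < Nat.find hex := by omega
    have := Nat.find_min hex hlt
    rw [Function.iterate_succ_apply']
    exact prune_not (h.iter_mem hv m) this hv rfl

theorem prune_eff (h : IsSkel ρ V r par ω Λ) (hρ : IsPM ρ)
    (hTR : T ≤ R) (hR : 0 ≤ R) {v : X} (hv : v ∈ prune V r par dep R) :
    eff ω (leaves (prune V r par dep R) r par) R v ≤ eff ω Λ T v := by
  have hvV := prune_sub _ _ _ _ _ hv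
  have hω := h.ω_nonneg hρ hvV
  unfold eff
  by_cases h1 : v ∈ leaves (prune V r par dep R) r par
  · rw [if_pos h1]
    split_ifs
    · exact max_le_max (by linarith) le_rfl
    · exact max_le (by linarith) hω
  · rw [if_neg h1, if_neg]
    by_cases hr : v = r
    · rw [hr]; exact h.root_notMem
    · have : ∃ u ∈ prune V r par dep R, par u = v := by
        by_contra hc
        push Not at hc
        exact h1 (Finset.mem_filter.2 ⟨hv, hr, hc⟩)
      obtain ⟨u, hu, rfl⟩ := this
      exact h.Λ_leaf u (prune_sub _ _ _ _ _ hu)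

theorem prune_gain (h : IsSkel ρ V r par ω Λ) (hρ : IsPM ρ) (hTR : T ≤ R) (hR : 0 ≤ R) :
    ∑ v ∈ V \ prune V r par dep R, eff ω Λ T v +
      Phi (prune V r par dep R) ω (leaves (prune V r par dep R) r par) R ≤ Phi V ω Λ T := by
  rw [Phi, Phi, ← Finset.sum_sdiff (prune_sub V r par dep R)]
  gcongr with v hv
  exact h.prune_eff hρ hTR hR hv

theorem prune_gain_leaves (h : IsSkel ρ V r par ω Λ) (hρ : IsPM ρ) (hd : IsDep V r par ω dep)
    (hT : 0 ≤ T) (hTR : T ≤ R) (hR : 0 ≤ R) :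
    ((leaves (prune V r par dep R) r par).card : ℝ) * (R - T) +
      Phi (prune V r par dep R) ω (leaves (prune V r par dep R) r par) R ≤ Phi V ω Λ T := by
  set V1 := prune V r par dep R with hV1
  set Λ1 := leaves V1 r par with hΛ1
  have h1 : IsSkel ρ V1 r par ω Λ1 := h.prune_skel hρ hd R
  set B : X → Finset X := fun l => V.filter fun u => ∃ n : ℕ, par^[n] u = l with hB
  have hno : ∀ (l : X), l ∈ Λ1 → ∀ (u : X), u ∈ V1 → ∀ n : ℕ, par^[n] u = l → u = l := by
    intro l hl u hu n hn
    rcases n with _ | m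
    · exact hn
    · rw [Function.iterate_succ_apply'] at hn
      exact absurd hn ((Finset.mem_filter.1 hl).2.2 _ (h1.iter_mem hu m))
  have hdisj : (Λ1 : Set X).PairwiseDisjoint B := by
    intro l hl l' hl' hne
    rw [Function.onFun, Finset.disjoint_left]
    intro u hu hu'
    obtain ⟨_, n, hn⟩ := Finset.mem_filter.1 hu
    obtain ⟨_, m, hm⟩ := Finset.mem_filter.1 hu'
    rcases le_total n m with hnm | hnm
    · rw [← Nat.sub_add_cancel hnm, Function.iterate_add_apply, hn] at hm
      exact hne (hno l' hl' l (leaves_sub _ _ _ hl) _ hm)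
    · rw [← Nat.sub_add_cancel hnm, Function.iterate_add_apply, hm] at hn
      exact hne (hno l hl l' (leaves_sub _ _ _ hl') _ hn).symm
  have hW : Disjoint (V1 \ Λ1) (Λ1.biUnion B) := by
    rw [Finset.disjoint_left]
    intro u hu hu'
    obtain ⟨l, hl, hul⟩ := Finset.mem_biUnion.1 hu'
    obtain ⟨_, n, hn⟩ := Finset.mem_filter.1 hul
    obtain ⟨hu1, hu2⟩ := Finset.mem_sdiff.1 hu
    rw [hno l hl u hu1 n hn] at hu2
    exact hu2 hl
  have hsub : (V1 \ Λ1) ∪ Λ1.biUnion B ⊆ V := by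
    intro u hu
    rcases Finset.mem_union.1 hu with hu | hu
    · exact prune_sub _ _ _ _ _ (Finset.mem_sdiff.1 hu).1
    · obtain ⟨l, hl, hul⟩ := Finset.mem_biUnion.1 hu
      exact (Finset.mem_filter.1 hul).1
  have hbig : ∑ u ∈ V1 \ Λ1, eff ω Λ T u + ∑ l ∈ Λ1, ∑ u ∈ B l, eff ω Λ T u ≤ Phi V ω Λ T := by
    rw [← Finset.sum_biUnion hdisj, ← Finset.sum_union hW]
    exact Finset.sum_le_sum_of_subset_of_nonneg hsub fun u hu _ => h.eff_nonneg hρ hu T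
  have hleaf : ∀ l ∈ Λ1, eff ω Λ1 R l + (R - T) ≤ ∑ u ∈ B l, eff ω Λ T u := by
    intro l hl
    obtain ⟨hl1, hlr, _⟩ := Finset.mem_filter.1 hl
    obtain ⟨hlV, hl2⟩ := Finset.mem_filter.1 hl1
    obtain ⟨x, hx, n, hxn, hxR⟩ := hl2.resolve_left hlr
    have hp := h.sum_path_le hρ hd hx hT (k := n + 1) (B := B l) (by
      intro j hj hc
      have : par^[n] x = r := by
        rw [← Nat.sub_add_cancel (Nat.lt_succ_iff.1 hj), Function.iterate_add_apply, hc, h.iter_root]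
      exact hlr (hxn ▸ this)) (Finset.filter_subset _ _) (by
      intro j hj
      refine Finset.mem_filter.2 ⟨h.iter_mem hx j, n - j, ?_⟩
      rw [← Function.iterate_add_apply, Nat.sub_add_cancel (Nat.lt_succ_iff.1 hj), hxn])
    rw [Function.iterate_succ_apply', hxn] at hp
    have h2 := h.dep_anti hρ hd hx n
    rw [hxn] at h2
    have h3 := hd.step l hlV
    rw [eff, if_pos hl]
    rcases le_total (ω l - R) 0 with h4 | h4
    · rw [max_eq_right h4]; linarith
    · rw [max_eq_left h4]; linarith
  have hsum := Finset.sum_le_sum hleaf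
  rw [Finset.sum_add_distrib, Finset.sum_const, nsmul_eq_mul] at hsum
  have hW1 : ∑ u ∈ V1 \ Λ1, eff ω Λ1 R u ≤ ∑ u ∈ V1 \ Λ1, eff ω Λ T u :=
    Finset.sum_le_sum fun u hu => h.prune_eff hρ hTR hR (Finset.mem_sdiff.1 hu).1
  have hPhi : Phi V1 ω Λ1 R = ∑ u ∈ V1 \ Λ1, eff ω Λ1 R u + ∑ u ∈ Λ1, eff ω Λ1 R u := by
    rw [Phi, Finset.sum_sdiff (leaves_sub _ _ _)]
  rw [hPhi]
  linarith

theorem leaves_empty (h : IsSkel ρ V r par ω Λ) (hρ : IsPM ρ) (hd : IsDep V r par ω dep)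
    (he : leaves V r par = ∅) : V = {r} := by
  by_contra hne
  have : (V.erase r).Nonempty := by
    by_contra hc
    rw [Finset.not_nonempty_iff_eq_empty, Finset.erase_eq_empty_iff] at hc
    rcases hc with hc | hc
    · have := h.root_mem
      rw [hc] at this; simp at this
    · exact hne hc
  obtain ⟨v, hv, hmax⟩ := Finset.exists_max_image _ dep this
  obtain ⟨hvr, hvV⟩ := Finset.mem_erase.1 hv
  have : v ∈ leaves V r par := by
    refine Finset.mem_filter.2 ⟨hvV, hvr, ?_⟩
    intro u hu huv
    have hur : u ≠ r := by
      rintro rfl; rw [h.par_root] at huv; exact hvr huv.symm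
    have h1 := hmax u (Finset.mem_erase.2 ⟨hur, hu⟩)
    have h2 := hd.step u hu
    have h3 := h.ω_pos hρ hu hur
    rw [huv] at h2
    linarith
  rw [he] at this
  simp at this

end IsSkel
end LightSpanner

noncomputable section LightSpanner
open scoped Classical
set_option linter.unusedSectionVars false

/-! ### Chains and counting -/

/-- `u` has at most one child. -/
def Single {X : Type u} (V : Finset X) (par : X → X) (u : X) : Prop :=
  ∀ c ∈ V, ∀ c' ∈ V, par c = u → par c' = u → c = c'

/-- The ancestors of `v` up to height `R` are neither the root nor branching. -/
def Clean {X : Type u} (V : Finset X) (r : X) (par : X → X) (dep : X → ℝ) (R : ℝ) (v : X) : Prop :=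
  ∀ n : ℕ, 1 ≤ n → dep v - dep (par^[n] v) < R → par^[n] v ≠ r ∧ Single V par (par^[n] v)

theorem chain_lemma {X : Type u} {V : Finset X} {r : X} {par : X → X} (h : IsTree V r par)
    {v2 : X} (hv2 : v2 ∈ V) (k1 : ℕ) : ∀ (v1 : X), v1 ∈ V → ∀ (k2 : ℕ), k1 ≤ k2 →
    par^[k1] v1 = par^[k2] v2 → (∀ j, 1 ≤ j → j ≤ k1 → Single V par (par^[j] v1)) →
    par^[k2 - k1] v2 = v1 := by
  induction k1 with
  | zero => intro v1 _ k2 _ he _; simpa using he.symm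
  | succ k ih =>
    intro v1 hv1 k2 hk he hs
    obtain ⟨m, rfl⟩ : ∃ m, k2 = m + 1 := ⟨k2 - 1, by omega⟩
    have h1 := hs (k + 1) (by omega) le_rfl
    rw [Function.iterate_succ_apply'] at h1 he
    rw [Function.iterate_succ_apply'] at he
    have h2 := h1 _ (h.iter_mem hv1 k) _ (h.iter_mem hv2 m) rfl he.symm
    have := ih v1 hv1 m (by omega) h2 (fun j hj hjk => hs j hj (by omega))
    rw [Nat.add_sub_add_right]; exact this

theorem IsSkel.chain_dist {X : Type u} [MetricSpace X] {ρ : X → X → ℝ} {V : Finset X} {r : X}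
    {par : X → X} {ω : X → ℝ} {Λ : Finset X} {dep : X → ℝ} (h : IsSkel ρ V r par ω Λ)
    (hρ : IsPM ρ) (hd : IsDep V r par ω dep) {v1 v2 : X} (hv1 : v1 ∈ V) (hv2 : v2 ∈ V)
    {k1 k2 : ℕ} (he : par^[k1] v1 = par^[k2] v2)
    (h1 : ∀ j, 1 ≤ j → j ≤ k1 → Single V par (par^[j] v1))
    (h2 : ∀ j, 1 ≤ j → j ≤ k2 → Single V par (par^[j] v2)) :
    ρ v1 v2 ≤ |dep v1 - dep v2| := by
  rcases le_total k1 k2 with hk | hk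
  · have := chain_lemma h.toIsTree hv2 k1 v1 hv1 k2 hk he h1
    have h3 := h.ρ_le hρ hd hv2 (k2 - k1)
    rw [this] at h3
    rw [hρ.symm, abs_sub_comm]
    exact h3.trans (le_abs_self _)
  · have := chain_lemma h.toIsTree hv1 k2 v2 hv2 k1 hk he.symm h2
    have h3 := h.ρ_le hρ hd hv1 (k1 - k2)
    rw [this] at h3
    exact h3.trans (le_abs_self _)

theorem bucket {X : Type u} [MetricSpace X] {τ B : ℝ} (hτ : 0 < τ) (hB0 : 0 ≤ B) {M : ℕ} {Q : Finset X}
    (hM : ∀ Q' ⊆ Q, (∀ p ∈ Q', ∀ q ∈ Q', dist p q ≤ 9 * τ) → Q'.card ≤ M)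
    (h : X → ℝ) (h0 : ∀ p ∈ Q, 0 ≤ h p) (hB : ∀ p ∈ Q, h p ≤ B)
    (hd : ∀ p ∈ Q, ∀ q ∈ Q, |h p - h q| ≤ τ → dist p q ≤ 9 * τ) :
    (Q.card : ℝ) ≤ M * (B / τ + 1) := by
  have h1 := Finset.card_le_mul_card_image_of_maps_to (s := Q)
    (t := Finset.range (⌊B / τ⌋₊ + 1)) (f := fun p => ⌊h p / τ⌋₊) (by
      intro p hp
      rw [Finset.mem_range, Nat.lt_succ_iff]
      exact Nat.floor_le_floor (by gcongr; exact hB p hp)) M (by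
      intro b _
      apply hM _ (Finset.filter_subset _ _)
      intro p hp q hq
      rw [Finset.mem_filter] at hp hq
      apply hd p hp.1 q hq.1
      have hp1 := Nat.floor_le (div_nonneg (h0 p hp.1) hτ.le)
      have hp2 := Nat.lt_floor_add_one (h p / τ)
      have hq1 := Nat.floor_le (div_nonneg (h0 q hq.1) hτ.le)
      have hq2 := Nat.lt_floor_add_one (h q / τ)
      have e1 := hp.2
      have e2 := hq.2
      rw [e1] at hp1 hp2
      rw [e2] at hq1 hq2
      rw [le_div_iff₀ hτ] at hp1 hq1
      rw [div_lt_iff₀ hτ] at hp2 hq2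
      rw [abs_le]; constructor <;> nlinarith)
  rw [Finset.card_range] at h1
  have h2 : ((⌊B / τ⌋₊ : ℕ) : ℝ) ≤ B / τ := Nat.floor_le (div_nonneg hB0 hτ.le)
  calc (Q.card : ℝ) ≤ ((M * (⌊B / τ⌋₊ + 1) : ℕ) : ℝ) := by exact_mod_cast h1
    _ = M * ((⌊B / τ⌋₊ : ℝ) + 1) := by push_cast; ring
    _ ≤ M * (B / τ + 1) := by gcongr

section
variable {X : Type u} [MetricSpace X] {ρ : X → X → ℝ} {V : Finset X} {r : X} {par : X → X}
    {ω : X → ℝ} {Λ : Finset X} {dep : X → ℝ} {τ B A : ℝ} {M : ℕ} {N : Finset X}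

theorem near_dist (hρ : IsPM ρ) {p q a b : X} {s : ℝ} (hp : ρ p a ≤ 4 * τ) (hq : ρ q b ≤ 4 * τ)
    (hab : ρ a b ≤ s) : dist p q ≤ 8 * τ + s := by
  have h1 := hρ.dist_le p q
  have h2 := hρ.tri p a q
  have h3 := hρ.tri a b q
  rw [hρ.symm b q] at h3
  linarith

theorem chain_count (hρ : IsPM ρ) (hτ : 0 < τ) (hB : 0 ≤ B)
    (hM : ∀ Q' ⊆ N, (∀ p ∈ Q', ∀ q ∈ Q', dist p q ≤ 9 * τ) → Q'.card ≤ M)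
    {Q : Finset X} (hQ : Q ⊆ N) {f : X → X} (hf : ∀ p ∈ Q, ρ p (f p) ≤ 4 * τ)
    (hA : ∀ p ∈ Q, A ≤ dep (f p)) (hAB : ∀ p ∈ Q, dep (f p) ≤ A + B)
    (hch : ∀ p ∈ Q, ∀ q ∈ Q, ρ (f p) (f q) ≤ |dep (f p) - dep (f q)|) :
    (Q.card : ℝ) ≤ M * (B / τ + 1) := by
  apply bucket hτ hB (fun Q' h1 h2 => hM Q' (h1.trans hQ) h2) (fun p => dep (f p) - A)
  · intro p hp; linarith [hA p hp]
  · intro p hp; linarith [hAB p hp]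
  · intro p hp q hq hpq
    have := near_dist hρ (hf p hp) (hf q hq) (hch p hp q hq)
    have h2 : dep (f p) - A - (dep (f q) - A) = dep (f p) - dep (f q) := by ring
    rw [h2] at hpq
    linarith

/-- Class (i). -/
theorem count_one (h : IsSkel ρ V r par ω Λ) (hρ : IsPM ρ) (hd : IsDep V r par ω dep)
    (hτ : 0 < τ)
    (hM : ∀ Q' ⊆ N, (∀ p ∈ Q', ∀ q ∈ Q', dist p q ≤ 9 * τ) → Q'.card ≤ M)
    {V1 : Finset X} (hr1 : r ∈ V1)
    {Q : Finset X} (hQ : Q ⊆ N) {f : X → X} (hfV : ∀ p ∈ Q, f p ∈ V) (hf : ∀ p ∈ Q, ρ p (f p) ≤ τ)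
    (hbad : ∀ p ∈ Q, ∀ n : ℕ, dep (f p) - dep (par^[n] (f p)) < 3 * τ → par^[n] (f p) ∉ V1) :
    (Q.card : ℝ) * (2 * τ) ≤ M * ∑ v ∈ V \ V1, eff ω Λ τ v := by
  set U : X → Finset X := fun p => (V \ V1).filter fun u =>
    ∃ n : ℕ, par^[n] (f p) = u ∧ dep (f p) - dep u < 3 * τ with hU
  have h1 : ∀ p ∈ Q, 2 * τ ≤ ∑ u ∈ V \ V1, if u ∈ U p then eff ω Λ τ u else 0 := by
    intro p hp
    have hex : ∃ n : ℕ, 3 * τ ≤ dep (f p) - dep (par^[n] (f p)) := by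
      obtain ⟨n, hn⟩ := h.reach _ (hfV p hp)
      refine ⟨n, ?_⟩
      by_contra hc
      push Not at hc
      exact hbad p hp n hc (by rw [hn]; exact hr1)
    have hlt : ∀ j < Nat.find hex, dep (f p) - dep (par^[j] (f p)) < 3 * τ := by
      intro j hj
      have := Nat.find_min hex hj
      push Not at this; exact this
    have h2 := h.sum_path_le hρ hd (hfV p hp) hτ.le (k := Nat.find hex) (B := U p) (by
      intro j hj hc
      exact hbad p hp j (hlt j hj) (by rw [hc]; exact hr1))
      ((Finset.filter_subset _ _).trans Finset.sdiff_subset) (by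
      intro j hj
      exact Finset.mem_filter.2 ⟨Finset.mem_sdiff.2 ⟨h.iter_mem (hfV p hp) j,
        hbad p hp j (hlt j hj)⟩, j, rfl, hlt j hj⟩)
    have h3 := Nat.find_spec hex
    rw [Finset.sum_ite_mem, Finset.inter_eq_right.2 (Finset.filter_subset _ _)]
    linarith
  have h2 := Finset.sum_le_sum h1
  rw [Finset.sum_const, nsmul_eq_mul, Finset.sum_comm] at h2
  refine h2.trans ?_
  rw [Finset.mul_sum]
  apply Finset.sum_le_sum
  intro u hu
  have he := h.eff_nonneg hρ (Finset.mem_sdiff.1 hu).1 τ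
  rw [← Finset.sum_filter, Finset.sum_const, nsmul_eq_mul]
  gcongr
  apply hM _ ((Finset.filter_subset _ _).trans hQ)
  have key : ∀ p ∈ Q.filter (fun p => u ∈ U p), ρ p u ≤ 4 * τ := by
    intro p hp
    obtain ⟨hp1, hp2⟩ := Finset.mem_filter.1 hp
    obtain ⟨_, n, hn, hlt⟩ := Finset.mem_filter.1 hp2
    have h3 := h.ρ_le hρ hd (hfV p hp1) n
    rw [hn] at h3
    have h4 := hρ.tri p (f p) u
    linarith [hf p hp1]
  intro p hp q hq
  have := near_dist hρ (key p hp) (key q hq) (s := τ) (by rw [hρ.self]; exact hτ.le)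
  linarith

/-- Class (ii). -/
theorem count_two (hρ : IsPM ρ) (hτ : 0 < τ)
    (hM : ∀ Q' ⊆ N, (∀ p ∈ Q', ∀ q ∈ Q', dist p q ≤ 9 * τ) → Q'.card ≤ M)
    {Q : Finset X} (hQ : Q ⊆ N) {f : X → X} (hf : ∀ p ∈ Q, ρ p (f p) ≤ 4 * τ)
    {W : Finset X} (hW : ∀ p ∈ Q, f p ∈ W) : (Q.card : ℝ) ≤ M * W.card := by
  have := Finset.card_le_mul_card_image_of_maps_to (s := Q) (t := W) (f := f) hW M (by
    intro b _
    apply hM _ ((Finset.filter_subset _ _).trans hQ)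
    intro p hp q hq
    rw [Finset.mem_filter] at hp hq
    have := near_dist hρ (hf p hp.1) (hf q hq.1) (s := τ)
      (by rw [hp.2, hq.2, hρ.self]; exact hτ.le)
    linarith)
  exact_mod_cast this

/-- Class (iii). -/
theorem count_three (h : IsSkel ρ V r par ω Λ) (hρ : IsPM ρ) (hd : IsDep V r par ω dep)
    (hτ : 0 < τ) (hB : 0 ≤ B)
    (hM : ∀ Q' ⊆ N, (∀ p ∈ Q', ∀ q ∈ Q', dist p q ≤ 9 * τ) → Q'.card ≤ M)
    {Q : Finset X} (hQ : Q ⊆ N) {f : X → X} (hf : ∀ p ∈ Q, ρ p (f p) ≤ 4 * τ)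
    (hfV : ∀ p ∈ Q, f p ∈ V) (hfr : ∀ p ∈ Q, f p ≠ r)
    (hbad : ∀ p ∈ Q, ¬ Clean V r par dep B (f p)) :
    (Q.card : ℝ) ≤ (tops V r par).card * (M * (B / τ + 1)) := by
  have key : ∀ p ∈ Q, ∃ n : ℕ, par^[n] (f p) ∈ tops V r par ∧
      dep (f p) - dep (par^[n] (f p)) ≤ B ∧
      ∀ j, 1 ≤ j → j ≤ n → Single V par (par^[j] (f p)) := by
    intro p hp
    have h1 := hbad p hp
    unfold Clean at h1
    push Not at h1
    have hex : ∃ n : ℕ, 1 ≤ n ∧ dep (f p) - dep (par^[n] (f p)) < B ∧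
      (par^[n] (f p) ≠ r → ¬ Single V par (par^[n] (f p))) := h1
    obtain ⟨hn1, hn2, hn3⟩ := Nat.find_spec hex
    obtain ⟨m, hm⟩ : ∃ m, Nat.find hex = m + 1 := ⟨Nat.find hex - 1, by omega⟩
    rw [hm] at hn1 hn2 hn3
    have hgood : ∀ j, 1 ≤ j → j ≤ m → par^[j] (f p) ≠ r ∧ Single V par (par^[j] (f p)) := by
      intro j hj hjm
      have h2 := Nat.find_min hex (m := j) (by omega)
      have h3 := h.dep_anti' hρ hd (hfV p hp) (show j ≤ m + 1 by omega)
      by_contra hc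
      exact h2 ⟨hj, by linarith, fun hr hs => hc ⟨hr, hs⟩⟩
    refine ⟨m, ?_, ?_, fun j hj hjm => (hgood j hj hjm).2⟩
    · have hmr : par^[m] (f p) ≠ r := by
        rcases Nat.eq_zero_or_pos m with rfl | hm0
        · exact hfr p hp
        · exact (hgood m hm0 le_rfl).1
      have hmV := h.iter_mem (hfV p hp) m
      refine Finset.mem_filter.2 ⟨Finset.mem_erase.2 ⟨hmr, hmV⟩, ?_⟩
      rw [Function.iterate_succ_apply'] at hn3
      by_cases hpr : par (par^[m] (f p)) = r
      · exact Or.inl hpr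
      · right
        have := hn3 hpr
        unfold Single at this
        push Not at this
        obtain ⟨c, hc, c', hc', e1, e2, hne⟩ := this
        by_cases hcm : c = par^[m] (f p)
        · exact ⟨c', hc', by rw [← hcm]; exact hne.symm, e2⟩
        · exact ⟨c, hc, hcm, e1⟩
    · have h3 := h.dep_anti' hρ hd (hfV p hp) (show m ≤ m + 1 by omega)
      linarith
  choose! n hn1 hn2 hn3 using key
  have h1 : (Q.card : ℝ) = ∑ c ∈ tops V r par,
      ((Q.filter fun p => par^[n p] (f p) = c).card : ℝ) := by
    rw [Finset.card_eq_sum_card_fiberwise (f := fun p => par^[n p] (f p)) (t := tops V r par) hn1]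
    push_cast; rfl
  rw [h1, ← nsmul_eq_mul]
  apply Finset.sum_le_card_nsmul
  intro c _
  apply chain_count hρ hτ hB hM ((Finset.filter_subset _ _).trans hQ) (f := f) (dep := dep)
    (A := dep c)
  · intro p hp; exact hf p (Finset.mem_filter.1 hp).1
  · intro p hp
    obtain ⟨hp1, rfl⟩ := Finset.mem_filter.1 hp
    exact h.dep_anti hρ hd (hfV p hp1) _
  · intro p hp
    obtain ⟨hp1, rfl⟩ := Finset.mem_filter.1 hp
    linarith [hn2 p hp1]
  · intro p hp q hq
    obtain ⟨hp1, hp2⟩ := Finset.mem_filter.1 hp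
    obtain ⟨hq1, hq2⟩ := Finset.mem_filter.1 hq
    exact h.chain_dist hρ hd (hfV p hp1) (hfV q hq1) (hp2.trans hq2.symm) (hn3 p hp1) (hn3 q hq1)

end
end LightSpanner

noncomputable section LightSpanner
open scoped Classical
set_option linter.unusedSectionVars false

/-! ### Modifying the skeleton -/

section
variable {X : Type u} [MetricSpace X] {ρ ρ' : X → X → ℝ} {V : Finset X} {r : X} {par : X → X}
    {ω : X → ℝ} {Λ : Finset X} {dep : X → ℝ} {L g R : ℝ}

theorem mod_one (h : IsSkel ρ V r par ω Λ) (hρ : IsPM ρ) (hR : 0 ≤ R) {a b : X} {k : ℕ} {w : ℝ}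
    (ha : a ∈ V) (hb : b ∈ V) (har : a ≠ r) (haΛ : a ∉ Λ) (hw : ρ a b ≤ w)
    (hba : ∀ n : ℕ, par^[n] b ≠ a) (hk : 1 ≤ k)
    (hxr : ∀ j, 1 ≤ j → j < k → par^[j] a ≠ r)
    (huniq : ∀ j, j + 1 < k → ∀ v ∈ V, par v = par^[j + 1] a → v = par^[j] a)
    (hbD : ∀ j, 1 ≤ j → j < k → b ≠ par^[j] a) :
    ∃ D : Finset X, (∀ v, v ∈ D ↔ ∃ j, 1 ≤ j ∧ j < k ∧ v = par^[j] a) ∧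
      IsSkel ρ (V \ D) r (Function.update par a b) (Function.update ω a w) (Λ.erase b) ∧
      a ∉ D ∧
      Phi (V \ D) (Function.update ω a w) (Λ.erase b) R + ∑ j ∈ Finset.range k, ω (par^[j] a) ≤
        Phi V ω Λ R + w + (if b ∈ Λ then R else 0) := by
  have hxr' : ∀ j < k, par^[j] a ≠ r := by
    intro j hj
    rcases Nat.eq_zero_or_pos j with rfl | h0
    · exact har
    · exact hxr j h0 hj
  have hinj := h.injOn ha hxr'
  set D : Finset X := (Finset.range (k - 1)).image fun j => par^[j + 1] a with hD
  have hmem : ∀ v, v ∈ D ↔ ∃ j, 1 ≤ j ∧ j < k ∧ v = par^[j] a := by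
    intro v
    simp only [hD, Finset.mem_image, Finset.mem_range]
    constructor
    · rintro ⟨j, hj, rfl⟩; exact ⟨j + 1, by omega, by omega, rfl⟩
    · rintro ⟨j, hj1, hj2, rfl⟩
      exact ⟨j - 1, by omega, by rw [Nat.sub_add_cancel hj1]⟩
  have haD : a ∉ D := by
    intro hc
    obtain ⟨j, hj1, hj2, he⟩ := (hmem a).1 hc
    have := hinj (x₁ := 0) (x₂ := j) (by simp; omega) (by simpa using hj2) (by simpa using he)
    omega
  have hDV : D ⊆ V := by
    intro v hv
    obtain ⟨j, _, _, rfl⟩ := (hmem v).1 hv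
    exact h.iter_mem ha j
  have hDΛ : ∀ v ∈ D, v ∉ Λ := by
    intro v hv
    obtain ⟨j, hj, _, rfl⟩ := (hmem v).1 hv
    obtain ⟨i, rfl⟩ : ∃ i, j = i + 1 := ⟨j - 1, by omega⟩
    rw [Function.iterate_succ_apply']
    exact h.Λ_leaf _ (h.iter_mem ha i)
  have hbD' : b ∉ D := by
    intro hc
    obtain ⟨j, hj1, hj2, he⟩ := (hmem b).1 hc
    exact hbD j hj1 hj2 he
  have hab : a ≠ b := fun he => hba 0 he.symm
  have htree := h.toIsTree.reparent (a := a) (b := b) (D := D) har hb (by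
      intro hc
      obtain ⟨j, hj1, hj2, he⟩ := (hmem r).1 hc
      exact hxr j hj1 hj2 he.symm) hbD' (by
      intro v hv hc
      obtain ⟨j, hj1, hj2, he⟩ := (hmem _).1 hc
      obtain ⟨i, rfl⟩ : ∃ i, j = i + 1 := ⟨j - 1, by omega⟩
      have := huniq i hj2 v hv he
      rcases Nat.eq_zero_or_pos i with rfl | hi
      · exact Or.inr this
      · exact Or.inl ((hmem v).2 ⟨i, hi, by omega, this⟩)) hba
  refine ⟨D, hmem, ⟨htree, ?_, ?_, ?_, ?_⟩, haD, ?_⟩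
  · rw [Function.update_of_ne har.symm, h.ω_root]
  · intro v hv
    by_cases hva : v = a
    · subst hva; simpa using hw
    · rw [Function.update_of_ne hva, Function.update_of_ne hva]
      exact h.ω_ge v (Finset.mem_sdiff.1 hv).1
  · intro v hv
    have hv' := Finset.mem_of_mem_erase hv
    exact Finset.mem_sdiff.2 ⟨h.Λ_sub hv', fun hc => hDΛ v hc hv'⟩
  · intro v hv
    by_cases hva : v = a
    · subst hva; simp
    · rw [Function.update_of_ne hva]
      intro hc
      exact h.Λ_leaf v (Finset.mem_sdiff.1 hv).1 (Finset.mem_of_mem_erase hc)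
  · have haV : a ∈ V \ D := Finset.mem_sdiff.2 ⟨ha, haD⟩
    have hbV : b ∈ V \ D := Finset.mem_sdiff.2 ⟨hb, hbD'⟩
    have e1 : Phi V ω Λ R = ∑ v ∈ V \ D, eff ω Λ R v + ∑ v ∈ D, ω v := by
      rw [Phi, ← Finset.sum_sdiff hDV]
      congr 1
      exact Finset.sum_congr rfl fun v hv => by rw [eff, if_neg (hDΛ v hv)]
    have e2 : ∑ v ∈ D, ω v = ∑ j ∈ Finset.range (k - 1), ω (par^[j + 1] a) := by
      rw [hD, Finset.sum_image]
      intro i hi j hj hij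
      simp only [Finset.coe_range, Set.mem_Iio] at hi hj
      have := hinj (x₁ := i + 1) (x₂ := j + 1) (by simp; omega) (by simp; omega) hij
      omega
    have e3 : ∑ j ∈ Finset.range k, ω (par^[j] a) =
        ∑ j ∈ Finset.range (k - 1), ω (par^[j + 1] a) + ω a := by
      obtain ⟨m, rfl⟩ : ∃ m, k = m + 1 := ⟨k - 1, by omega⟩
      rw [Finset.sum_range_succ']; simp
    have e4 : Phi (V \ D) (Function.update ω a w) (Λ.erase b) R ≤
        ∑ v ∈ V \ D, (eff ω Λ R v + ((if v = a then w - ω a else 0) +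
          (if v = b then (if b ∈ Λ then R else 0) else 0))) := by
      apply Finset.sum_le_sum
      intro v _
      by_cases hva : v = a
      · subst hva
        rw [if_pos rfl, if_neg hab, eff, eff, if_neg haΛ,
          if_neg (fun hc => haΛ (Finset.mem_of_mem_erase hc)), Function.update_self]
        linarith
      · rw [if_neg hva]
        by_cases hvb : v = b
        · subst hvb
          rw [if_pos rfl, eff, eff, if_neg (Finset.notMem_erase _ _), Function.update_of_ne hva]
          split_ifs
          · have := le_max_left (ω v - R) 0
            linarith
          · linarith
        · rw [if_neg hvb, eff, eff, Function.update_of_ne hva]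
          have : v ∈ Λ.erase b ↔ v ∈ Λ := by simp [hvb]
          simp only [this]
          linarith
    rw [Finset.sum_add_distrib, Finset.sum_add_distrib, Finset.sum_ite_eq' (V \ D) a,
      Finset.sum_ite_eq' (V \ D) b, if_pos haV, if_pos hbV] at e4
    linarith

/-- Ancestors of `v` up to height `R`. -/
def Zone (V : Finset X) (par : X → X) (dep : X → ℝ) (R : ℝ) (v : X) : Finset X :=
  V.filter fun u => ∃ n : ℕ, par^[n] v = u ∧ dep v - dep u < R

theorem mem_Zone_self {v : X} (hv : v ∈ V) (hR : 0 < R) : v ∈ Zone V par dep R v :=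
  Finset.mem_filter.2 ⟨hv, 0, rfl, by simpa using hR⟩

/-- Vertices where modification may take place. -/
structure Good (V : Finset X) (r : X) (par : X → X) (Λ : Finset X) (dep : X → ℝ) (R : ℝ) (v : X) :
    Prop where
  mem : v ∈ V
  ne : v ≠ r
  notMem : v ∉ Λ
  clean : Clean V r par dep R v

/-- The state of the skeleton after processing the pairs in `S`. -/
structure ModState {ι : Type u} (ρ ρ' : X → X → ℝ) (V : Finset X) (r : X) (par : X → X)
    (ω : X → ℝ) (Λ : Finset X) (Z : ι → Finset X) (L g : ℝ) (S : Finset ι)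
    (V' : Finset X) (par' : X → X) (ω' : X → ℝ) (Λ' : Finset X) : Prop where
  skel : IsSkel ρ' V' r par' ω' Λ'
  subV : V' ⊆ V
  subΛ : Λ' ⊆ Λ
  out : ∀ v ∈ V, (∀ e ∈ S, v ∉ Z e) → v ∈ V' ∧ par' v = par v ∧ ω' v = ω v
  par_out : ∀ v ∈ V', (∀ e ∈ S, par' v ∉ Z e) → par' v = par v
  cover : ∀ v ∈ V, v ∈ V' ∨ ∃ v' ∈ V', (∃ e ∈ S, v' ∈ Z e) ∧ ρ v v' ≤ 6 * L
  phi : Phi V' ω' Λ' L + S.card * g ≤ Phi V ω Λ L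

theorem mod_step {ι : Type u} (h : IsSkel ρ V r par ω Λ) (hρ : IsPM ρ) (hd : IsDep V r par ω dep)
    (hρ' : IsPM ρ') (hL : 0 < L) (hgL : g ≤ L)
    {Z : ι → Finset X} {S : Finset ι} {e0 : ι} (he0 : e0 ∉ S)
    (hdisj : ∀ e ∈ S, Disjoint (Z e) (Z e0))
    {a b : X} {w : ℝ} (hZ : Zone V par dep (6 * L) a ∪ Zone V par dep (6 * L) b ⊆ Z e0)
    (ha : Good V r par Λ dep (6 * L) a) (hb : b ∈ V)
    (hw1 : ρ' a b ≤ w) (hw2 : w ≤ 4 * L) (hw3 : w + g ≤ ρ a b)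
    {V' : Finset X} {par' : X → X} {ω' : X → ℝ} {Λ' : Finset X}
    (hs : ModState ρ ρ' V r par ω Λ Z L g S V' par' ω' Λ')
    (hba : ∀ n : ℕ, par'^[n] b ≠ a) :
    ∃ V'' par'' ω'' Λ'', ModState ρ ρ' V r par ω Λ Z L g (insert e0 S) V'' par'' ω'' Λ'' := by
  have h6 : 0 < 6 * L := by linarith
  have hZa : ∀ v ∈ Zone V par dep (6 * L) a, v ∈ Z e0 := fun v hv => hZ (Finset.mem_union_left _ hv)
  have haZ : a ∈ Z e0 := hZa _ (mem_Zone_self ha.mem h6)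
  have hbZ : b ∈ Z e0 := hZ (Finset.mem_union_right _ (mem_Zone_self hb h6))
  have hun : ∀ v ∈ Z e0, ∀ e ∈ S, v ∉ Z e := fun v hv e he hc =>
    Finset.disjoint_left.1 (hdisj e he) hc hv
  have hex : ∃ n : ℕ, 6 * L ≤ dep a - dep (par^[n] a) := by
    obtain ⟨n, hn⟩ := h.reach a ha.mem
    refine ⟨n, ?_⟩
    by_contra hc
    push Not at hc
    have hn0 : 1 ≤ n := by
      by_contra h0
      have : n = 0 := by omega
      subst this
      exact ha.ne hn
    exact (ha.clean n hn0 hc).1 hn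
  obtain ⟨K, hK1, hK2⟩ : ∃ K : ℕ, 6 * L ≤ dep a - dep (par^[K] a) ∧
      ∀ j < K, dep a - dep (par^[j] a) < 6 * L := by
    refine ⟨Nat.find hex, Nat.find_spec hex, fun j hj => ?_⟩
    have := Nat.find_min hex hj
    push Not at this; exact this
  have hKpos : 1 ≤ K := by
    by_contra h0
    have : K = 0 := by omega
    subst this
    simp at hK1; linarith
  have hzone : ∀ j < K, par^[j] a ∈ Z e0 := fun j hj =>
    hZa _ (Finset.mem_filter.2 ⟨h.iter_mem ha.mem j, j, rfl, hK2 j hj⟩)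
  have hout : ∀ v ∈ V, v ∈ Z e0 → v ∈ V' ∧ par' v = par v ∧ ω' v = ω v :=
    fun v hv hz => hs.out v hv (hun v hz)
  have hit : ∀ j ≤ K, par'^[j] a = par^[j] a := by
    intro j
    induction j with
    | zero => intro _; rfl
    | succ j ih =>
      intro hj
      rw [Function.iterate_succ_apply', Function.iterate_succ_apply', ih (by omega),
        (hout _ (h.iter_mem ha.mem j) (hzone j (by omega))).2.1]
  have hbV' : b ∈ V' := (hout b hb hbZ).1
  have haV' : a ∈ V' := (hout a ha.mem haZ).1
  have haΛ' : a ∉ Λ' := fun hc => ha.notMem (hs.subΛ hc)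
  -- the main construction
  have main : ∀ k : ℕ, 1 ≤ k → k ≤ K → (∀ j, 1 ≤ j → j < k → b ≠ par^[j] a) →
      (w + g + (if b ∈ Λ' then L else 0) ≤ dep a - dep (par^[k] a)) →
      ∃ V'' par'' ω'' Λ'', ModState ρ ρ' V r par ω Λ Z L g (insert e0 S) V'' par'' ω'' Λ'' := by
    intro k hk1 hkK hbk hgain
    obtain ⟨D, hDm, hsk, haD, hphi⟩ := mod_one (R := L) (k := k) hs.skel hρ' hL.le haV' hbV' ha.ne
      haΛ' hw1 hba hk1 (by
        intro j hj1 hjk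
        rw [hit j (by omega)]
        exact (ha.clean j hj1 (hK2 j (by omega))).1) (by
        intro j hjk v hv hpv
        rw [hit _ (by omega)] at hpv
        rw [hit _ (by omega)]
        have h1 : par' v = par v := hs.par_out v hv (by
          rw [hpv]; exact hun _ (hzone _ (by omega)))
        refine (ha.clean (j + 1) (by omega) (hK2 _ (by omega))).2 v (hs.subV hv) _
          (h.iter_mem ha.mem j) (h1 ▸ hpv) ?_
        rw [Function.iterate_succ_apply']) (by
        intro j hj1 hjk
        rw [hit j (by omega)]
        exact hbk j hj1 hjk)
    have hDZ : ∀ v ∈ D, ∃ j, 1 ≤ j ∧ j < K ∧ v = par^[j] a := by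
      intro v hv
      obtain ⟨j, hj1, hjk, rfl⟩ := (hDm v).1 hv
      exact ⟨j, hj1, by omega, hit j (by omega)⟩
    have hDZ' : ∀ v ∈ D, v ∈ Z e0 := by
      intro v hv
      obtain ⟨j, _, hj, rfl⟩ := hDZ v hv
      exact hzone j hj
    refine ⟨_, _, _, _, hsk, Finset.sdiff_subset.trans hs.subV, (Finset.erase_subset _ _).trans hs.subΛ,
      ?_, ?_, ?_, ?_⟩
    · intro v hv hve
      have h0 := hve e0 (Finset.mem_insert_self _ _)
      obtain ⟨h1, h2, h3⟩ := hs.out v hv fun e he => hve e (Finset.mem_insert_of_mem he)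
      have hva : v ≠ a := by rintro rfl; exact h0 haZ
      exact ⟨Finset.mem_sdiff.2 ⟨h1, fun hc => h0 (hDZ' v hc)⟩,
        by rw [Function.update_of_ne hva, h2], by rw [Function.update_of_ne hva, h3]⟩
    · intro v hv hve
      by_cases hva : v = a
      · subst hva
        rw [Function.update_self] at hve
        exact absurd hbZ (hve e0 (Finset.mem_insert_self _ _))
      · rw [Function.update_of_ne hva] at hve ⊢
        exact hs.par_out v (Finset.mem_sdiff.1 hv).1 fun e he => hve e (Finset.mem_insert_of_mem he)
    · intro v hv
      rcases hs.cover v hv with h1 | ⟨v', hv', ⟨e, he, hve⟩, hle⟩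
      · by_cases hvD : v ∈ D
        · right
          refine ⟨a, Finset.mem_sdiff.2 ⟨haV', haD⟩, ⟨e0, Finset.mem_insert_self _ _, haZ⟩, ?_⟩
          obtain ⟨j, _, hj, rfl⟩ := hDZ v hvD
          rw [hρ.symm]
          exact (h.ρ_le hρ hd ha.mem j).trans (hK2 j hj).le
        · exact Or.inl (Finset.mem_sdiff.2 ⟨h1, hvD⟩)
      · right
        refine ⟨v', Finset.mem_sdiff.2 ⟨hv', fun hc => ?_⟩, ⟨e, Finset.mem_insert_of_mem he, hve⟩, hle⟩
        exact hun v' (hDZ' v' hc) e he hve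
    · have hsum : ∑ j ∈ Finset.range k, ω' (par'^[j] a) = dep a - dep (par^[k] a) := by
        rw [← h.dep_sum hd ha.mem k]
        apply Finset.sum_congr rfl
        intro j hj
        rw [Finset.mem_range] at hj
        rw [hit j (by omega), (hout _ (h.iter_mem ha.mem j) (hzone j (by omega))).2.2]
      rw [hsum] at hphi
      have hp := hs.phi
      rw [Finset.card_insert_of_notMem he0]
      push_cast
      linarith
  by_cases hbx : ∃ j, 1 ≤ j ∧ j < K ∧ b = par^[j] a
  · have hm := Nat.find_spec hbx
    have hmin : ∀ j < Nat.find hbx, ¬ (1 ≤ j ∧ j < K ∧ b = par^[j] a) := fun j hj => Nat.find_min hbx hj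
    set k := Nat.find hbx
    apply main k hm.1 hm.2.1.le
    · intro j hj1 hjk he
      exact hmin j hjk ⟨hj1, by omega, he⟩
    · have h1 := h.ρ_le hρ hd ha.mem k
      rw [← hm.2.2] at h1 ⊢
      rw [if_neg]
      · linarith
      · intro hc
        have h2 := hs.subΛ hc
        obtain ⟨i, hi⟩ : ∃ i, k = i + 1 := ⟨k - 1, by omega⟩
        rw [hm.2.2, hi, Function.iterate_succ_apply'] at h2
        exact h.Λ_leaf _ (h.iter_mem ha.mem i) h2
  · push Not at hbx
    apply main K hKpos le_rfl (fun j h1 h2 => hbx j h1 h2)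
    split_ifs <;> linarith

theorem mods {ι : Type u} (h : IsSkel ρ V r par ω Λ) (hρ : IsPM ρ) (hd : IsDep V r par ω dep)
    (hρ' : IsPM ρ') (hle : ∀ x y, ρ' x y ≤ ρ x y) (hL : 0 < L) (hg : 0 < g) (hgL : g ≤ L)
    {a b : ι → X} {w : ι → ℝ} (S : Finset ι)
    (hdisj : ∀ e ∈ S, ∀ e' ∈ S, e ≠ e' → Disjoint
      (Zone V par dep (6 * L) (a e) ∪ Zone V par dep (6 * L) (b e))
      (Zone V par dep (6 * L) (a e') ∪ Zone V par dep (6 * L) (b e')))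
    (ha : ∀ e ∈ S, Good V r par Λ dep (6 * L) (a e))
    (hb : ∀ e ∈ S, Good V r par Λ dep (6 * L) (b e))
    (hw1 : ∀ e ∈ S, ρ' (a e) (b e) ≤ w e) (hw2 : ∀ e ∈ S, w e ≤ 4 * L)
    (hw3 : ∀ e ∈ S, w e + g ≤ ρ (a e) (b e)) :
    ∃ V' par' ω' Λ', ModState ρ ρ' V r par ω Λ
      (fun e => Zone V par dep (6 * L) (a e) ∪ Zone V par dep (6 * L) (b e)) L g S
      V' par' ω' Λ' := by
  induction S using Finset.induction_on with
  | empty =>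
    refine ⟨V, par, ω, Λ, ⟨h.toIsTree, h.ω_root, fun v hv => (hle _ _).trans (h.ω_ge v hv),
      h.Λ_sub, h.Λ_leaf⟩, subset_rfl, subset_rfl, fun v hv _ => ⟨hv, rfl, rfl⟩, fun _ _ _ => rfl,
      fun v hv => Or.inl hv, by simp⟩
  | insert e0 S he0 ih =>
    obtain ⟨V', par', ω', Λ', hs⟩ := ih
      (fun e he e' he' => hdisj e (Finset.mem_insert_of_mem he) e' (Finset.mem_insert_of_mem he'))
      (fun e he => ha e (Finset.mem_insert_of_mem he))
      (fun e he => hb e (Finset.mem_insert_of_mem he))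
      (fun e he => hw1 e (Finset.mem_insert_of_mem he))
      (fun e he => hw2 e (Finset.mem_insert_of_mem he))
      (fun e he => hw3 e (Finset.mem_insert_of_mem he))
    have hm := Finset.mem_insert_self e0 S
    have hdj : ∀ e ∈ S, Disjoint
      (Zone V par dep (6 * L) (a e) ∪ Zone V par dep (6 * L) (b e))
      (Zone V par dep (6 * L) (a e0) ∪ Zone V par dep (6 * L) (b e0)) := fun e he =>
      hdisj e (Finset.mem_insert_of_mem he) e0 hm (fun hc => he0 (hc ▸ he))
    by_cases hba : ∀ n : ℕ, par'^[n] (b e0) ≠ a e0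
    · exact mod_step h hρ hd hρ' hL hgL he0 hdj subset_rfl (ha e0 hm) (hb e0 hm).mem (hw1 e0 hm)
        (hw2 e0 hm) (hw3 e0 hm) hs hba
    · have hab : ∀ n : ℕ, par'^[n] (a e0) ≠ b e0 := by
        intro n hn
        push Not at hba
        obtain ⟨m, hm'⟩ := hba
        rw [← hm', ← Function.iterate_add_apply] at hn
        have hbV : b e0 ∈ V' := by
          refine (hs.out _ (hb e0 hm).mem fun e he hc => ?_).1
          exact Finset.disjoint_left.1 (hdj e he) hc (Finset.mem_union_right _
            (mem_Zone_self (hb e0 hm).mem (by linarith)))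
        have hne : b e0 ≠ a e0 := by
          intro hc
          have h1 := hw3 e0 hm
          have h2 := hw1 e0 hm
          rw [hc, hρ.self] at h1
          rw [hc, hρ'.self] at h2
          linarith
        have hpos : 0 < n + m := by
          by_contra h0
          have : m = 0 := by omega
          subst this
          exact hne hm'
        exact (hb e0 hm).ne (hs.skel.no_cycle hbV hpos hn)
      exact mod_step (a := b e0) (b := a e0) (w := w e0) h hρ hd hρ' hL hgL he0 hdj
        (by rw [Finset.union_comm]) (hb e0 hm) (ha e0 hm).mem (by rw [hρ'.symm]; exact hw1 e0 hm)
        (hw2 e0 hm) (by rw [hρ.symm]; exact hw3 e0 hm) hs hab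

end
end LightSpanner

noncomputable section LightSpanner
open scoped Classical
set_option linter.unusedSectionVars false

/-! ### One level of the construction -/

section
variable {X : Type u} [MetricSpace X] {ρ ρ' : X → X → ℝ} {V : Finset X} {r : X} {par : X → X}
    {ω : X → ℝ} {Λ : Finset X} {dep : X → ℝ} {L ε τ : ℝ} {M ME : ℕ} {N : Finset X}

theorem first_count (h : IsSkel ρ V r par ω Λ) (hρ : IsPM ρ) (hd : IsDep V r par ω dep)
    (hL : 0 < L) (hτ : 0 < τ) (hτL : 128 * τ ≤ L)
    (hcov : ∀ x, ∃ v ∈ V, ρ x v ≤ τ)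
    (hM : ∀ Q' ⊆ N, (∀ p ∈ Q', ∀ q ∈ Q', dist p q ≤ 9 * τ) → Q'.card ≤ M)
    {V1 Λ1 : Finset X} (hV1 : V1 = prune V r par dep L) (hΛ1 : Λ1 = leaves V1 r par) {G : ℝ}
    (hG : G = Phi V ω Λ τ - Phi V1 ω Λ1 L) (hGL : L / 8 ≤ G) :
    ∃ (f : X → X) (N1 : Finset X), N1 ⊆ N ∧
      (∀ p ∈ N, p ∉ N1 → Good V1 r par Λ1 dep (6 * L) (f p) ∧ ρ p (f p) ≤ 4 * τ) ∧
      (N1.card : ℝ) ≤ M * (29 * G / τ) := by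
  have h1 : IsSkel ρ V1 r par ω Λ1 := by rw [hΛ1, hV1]; exact h.prune_skel hρ hd L
  have hV1V : V1 ⊆ V := by rw [hV1]; exact prune_sub _ _ _ _ _
  have hd1 : IsDep V1 r par ω dep := ⟨hd.root, fun v hv => hd.step v (hV1V hv)⟩
  have hτL' : τ ≤ L := by linarith
  have g1 : ∑ v ∈ V \ V1, eff ω Λ τ v ≤ G := by
    have := h.prune_gain (dep := dep) hρ hτL' hL.le
    rw [← hV1, ← hΛ1] at this; linarith
  have g2 : (Λ1.card : ℝ) * (L - τ) ≤ G := by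
    have := h.prune_gain_leaves hρ hd hτ.le hτL' hL.le
    rw [← hV1, ← hΛ1] at this; linarith
  choose π hπ1 hπ2 using hcov
  set Q1 := N.filter fun p => ∀ n : ℕ, dep (π p) - dep (par^[n] (π p)) < 3 * τ →
    par^[n] (π p) ∉ V1 with hQ1
  have hf : ∀ p ∈ N, p ∉ Q1 → ∃ v, v ∈ V1 ∧ ρ p v ≤ 4 * τ := by
    intro p hp hpQ
    have : ¬ ∀ n : ℕ, dep (π p) - dep (par^[n] (π p)) < 3 * τ → par^[n] (π p) ∉ V1 :=
      fun hc => hpQ (Finset.mem_filter.2 ⟨hp, hc⟩)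
    push Not at this
    obtain ⟨n, hn1, hn2⟩ := this
    refine ⟨_, hn2, ?_⟩
    have h3 := h.ρ_le hρ hd (hπ1 p) n
    have h4 := hρ.tri p (π p) (par^[n] (π p))
    linarith [hπ2 p]
  choose! f hf1 hf2 using hf
  set Q2 := N.filter fun p => p ∉ Q1 ∧ f p ∈ insert r Λ1 with hQ2
  set Q3 := N.filter fun p => p ∉ Q1 ∧ f p ∉ insert r Λ1 ∧ ¬ Clean V1 r par dep (6 * L) (f p)
    with hQ3
  have c1 := count_one h hρ hd hτ hM (V1 := V1) h1.root_mem (Q := Q1) (Finset.filter_subset _ _)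
    (f := π) (fun p _ => hπ1 p) (fun p _ => hπ2 p) (fun p hp => (Finset.mem_filter.1 hp).2)
  have c2 := count_two hρ hτ hM (Q := Q2) (Finset.filter_subset _ _) (f := f) (by
    intro p hp
    obtain ⟨hp1, hp2, _⟩ := Finset.mem_filter.1 hp
    exact hf2 p hp1 hp2) (W := insert r Λ1) (by
    intro p hp
    exact (Finset.mem_filter.1 hp).2.2)
  have c3 := count_three h1 hρ hd1 hτ (B := 6 * L) (by linarith) hM (Q := Q3)
    (Finset.filter_subset _ _) (f := f) (by
    intro p hp
    obtain ⟨hp1, hp2, _⟩ := Finset.mem_filter.1 hp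
    exact hf2 p hp1 hp2) (by
    intro p hp
    obtain ⟨hp1, hp2, _⟩ := Finset.mem_filter.1 hp
    exact hf1 p hp1 hp2) (by
    intro p hp hc
    obtain ⟨hp1, hp2, hp3, _⟩ := Finset.mem_filter.1 hp
    exact hp3 (Finset.mem_insert.2 (Or.inl hc))) (by
    intro p hp
    exact (Finset.mem_filter.1 hp).2.2.2)
  refine ⟨f, Q1 ∪ Q2 ∪ Q3, ?_, ?_, ?_⟩
  · exact Finset.union_subset (Finset.union_subset (Finset.filter_subset _ _)
      (Finset.filter_subset _ _)) (Finset.filter_subset _ _)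
  · intro p hp hn
    rw [Finset.mem_union, Finset.mem_union] at hn
    push Not at hn
    obtain ⟨⟨n1, n2⟩, n3⟩ := hn
    have n2' : f p ∉ insert r Λ1 := fun hc => n2 (Finset.mem_filter.2 ⟨hp, n1, hc⟩)
    have n3' : Clean V1 r par dep (6 * L) (f p) := by
      by_contra hc
      exact n3 (Finset.mem_filter.2 ⟨hp, n1, n2', hc⟩)
    rw [Finset.mem_insert] at n2'
    push Not at n2'
    exact ⟨⟨hf1 p hp n1, n2'.1, n2'.2, n3'⟩, hf2 p hp n1⟩
  · have hcard : ((Q1 ∪ Q2 ∪ Q3).card : ℝ) ≤ Q1.card + Q2.card + Q3.card := by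
      have a1 := Finset.card_union_le (Q1 ∪ Q2) Q3
      have a2 := Finset.card_union_le Q1 Q2
      exact_mod_cast a1.trans (by omega)
    have hM0 : (0 : ℝ) ≤ M := by positivity
    have hl0 : (0 : ℝ) ≤ Λ1.card := by positivity
    have hG0 : 0 < G := by linarith
    have t1 : ((tops V1 r par).card : ℝ) ≤ 2 * Λ1.card := by
      rw [hΛ1]; exact_mod_cast h1.toIsTree.tops_card
    have t2 : ((insert r Λ1).card : ℝ) ≤ Λ1.card + 1 := by
      exact_mod_cast Finset.card_insert_le r Λ1
    -- in units of τ
    have u1 : (Q1.card : ℝ) ≤ M * (G / (2 * τ)) := by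
      rw [← mul_div_assoc, le_div_iff₀ (by positivity)]
      exact c1.trans (by gcongr)
    have lam : (Λ1.card : ℝ) ≤ 2 * G / L := by
      rw [le_div_iff₀ hL]; nlinarith
    have hGτ : G / L ≤ G / τ / 128 := by
      rw [div_div, div_le_div_iff₀ hL (by positivity)]; nlinarith
    have one : (1 : ℝ) ≤ 8 * (G / L) := by
      rw [← mul_div_assoc, le_div_iff₀ hL]; linarith
    have lam' : (Λ1.card : ℝ) ≤ 2 * (G / L) := by rw [← mul_div_assoc]; exact lam
    have u2 : (Q2.card : ℝ) ≤ M * (10 * (G / L)) := c2.trans (by gcongr; linarith)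
    have u3 : (Q3.card : ℝ) ≤ M * (28 * (G / τ)) := by
      have hLτ : 6 * L / τ + 1 ≤ 7 * L / τ := by
        rw [div_add_one hτ.ne', div_le_div_iff_of_pos_right hτ]; linarith
      calc (Q3.card : ℝ) ≤ (tops V1 r par).card * (M * (6 * L / τ + 1)) := c3
        _ ≤ (2 * (2 * (G / L))) * (M * (7 * L / τ)) := by gcongr; linarith
        _ = M * (28 * (G / τ)) := by field_simp; ring
    have hGt : 0 ≤ G / τ := by positivity
    have e1 : G / (2 * τ) = (G / τ) / 2 := by field_simp
    have e2 : 29 * G / τ = 29 * (G / τ) := by ring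
    rw [e1] at u1
    rw [e2]
    have : (M : ℝ) * (G / τ / 2) + M * (10 * (G / L)) + M * (28 * (G / τ)) ≤ M * (29 * (G / τ)) := by
      rw [← mul_add, ← mul_add]
      gcongr
      linarith
    linarith

theorem zone_count (h : IsSkel ρ V r par ω Λ) (hρ : IsPM ρ) (hd : IsDep V r par ω dep)
    (hL : 0 < L) (hτ : 0 < τ)
    (hM : ∀ Q' ⊆ N, (∀ p ∈ Q', ∀ q ∈ Q', dist p q ≤ 9 * τ) → Q'.card ≤ M)
    {s : X} (hs : Good V r par Λ dep L s) {Q : Finset X} (hQ : Q ⊆ N) {f : X → X}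
    (hf : ∀ p ∈ Q, ρ p (f p) ≤ 4 * τ) (hgood : ∀ p ∈ Q, Good V r par Λ dep L (f p))
    (hmeet : ∀ p ∈ Q, ¬ Disjoint (Zone V par dep L (f p)) (Zone V par dep L s)) :
    (Q.card : ℝ) ≤ M * (2 * L / τ + 1) := by
  have hk : ∀ p ∈ Q, ∃ k m : ℕ, par^[k] (f p) = par^[m] s ∧
      dep (f p) - dep (par^[k] (f p)) < L ∧ dep s - dep (par^[m] s) < L := by
    intro p hp
    obtain ⟨u, hu1, hu2⟩ := Finset.not_disjoint_iff.1 (hmeet p hp)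
    obtain ⟨_, k, hk, hk'⟩ := Finset.mem_filter.1 hu1
    obtain ⟨_, m, hm, hm'⟩ := Finset.mem_filter.1 hu2
    exact ⟨k, m, hk.trans hm.symm, by rw [hk]; exact hk', by rw [hm]; exact hm'⟩
  choose! k m hkm hk hm using hk
  have hsing : ∀ (v : X) (n : ℕ), Good V r par Λ dep L v → dep v - dep (par^[n] v) < L →
      ∀ j, 1 ≤ j → j ≤ n → Single V par (par^[j] v) := by
    intro v n hv hlt j hj hjn
    have := h.dep_anti' hρ hd hv.mem hjn
    exact (hv.clean j hj (by linarith)).2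
  have key : ∀ p ∈ Q, ∀ q ∈ Q, m p ≤ m q → ρ (f p) (f q) ≤ |dep (f p) - dep (f q)| := by
    intro p hp q hq hpq
    apply h.chain_dist hρ hd (hgood p hp).mem (hgood q hq).mem (k1 := (m q - m p) + k p) (k2 := k q)
    · rw [Function.iterate_add_apply, hkm p hp, hkm q hq, ← Function.iterate_add_apply,
        Nat.sub_add_cancel hpq]
    · intro j hj1 hj2
      rcases le_or_gt j (k p) with hjk | hjk
      · exact hsing _ _ (hgood p hp) (hk p hp) j hj1 hjk
      · rw [← Nat.sub_add_cancel hjk.le, Function.iterate_add_apply, hkm p hp,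
          ← Function.iterate_add_apply]
        exact hsing _ _ hs (hm q hq) _ (by omega) (by omega)
    · exact hsing _ _ (hgood q hq) (hk q hq)
  apply chain_count hρ hτ (by linarith) hM hQ hf (dep := dep) (A := dep s - L)
  · intro p hp
    have h1 := h.dep_anti hρ hd (hgood p hp).mem (k p)
    have h2 := hm p hp
    rw [hkm p hp] at h1
    linarith
  · intro p hp
    have h1 := h.dep_anti hρ hd hs.mem (m p)
    have h2 := hk p hp
    rw [hkm p hp] at h2
    linarith
  · intro p hp q hq
    rcases le_total (m p) (m q) with hpq | hpq
    · exact key p hp q hq hpq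
    · rw [hρ.symm, abs_sub_comm]
      exact key q hq p hp hpq

/-- Pairwise disjoint families. -/
def PairDisj {ι α : Type u} (Z : ι → Finset α) (S : Finset ι) : Prop :=
  ∀ e ∈ S, ∀ e' ∈ S, e ≠ e' → Disjoint (Z e) (Z e')

theorem exists_max_disj {ι α : Type u} (Q : Finset ι) (Z : ι → Finset α)
    (hne : ∀ e ∈ Q, (Z e).Nonempty) :
    ∃ S ⊆ Q, (∀ e ∈ S, ∀ e' ∈ S, e ≠ e' → Disjoint (Z e) (Z e')) ∧
      ∀ e ∈ Q, ∃ e' ∈ S, ¬ Disjoint (Z e) (Z e') := by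
  set F := Q.powerset.filter (PairDisj Z) with hF
  obtain ⟨S, hS, hmax⟩ := Finset.exists_max_image F Finset.card ⟨∅, by simp [hF, PairDisj]⟩
  obtain ⟨hS1, hS2⟩ := Finset.mem_filter.1 hS
  rw [Finset.mem_powerset] at hS1
  refine ⟨S, hS1, hS2, fun e he => ?_⟩
  by_contra hc
  push Not at hc
  have heS : e ∉ S := by
    intro h
    have h1 := hc e h
    rw [disjoint_self] at h1
    exact (hne e he).ne_empty h1
  have h2 := hmax (insert e S) (by
    refine Finset.mem_filter.2 ⟨Finset.mem_powerset.2 (Finset.insert_subset he hS1), ?_⟩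
    intro a ha b hb hab
    rcases Finset.mem_insert.1 ha with rfl | ha' <;> rcases Finset.mem_insert.1 hb with rfl | hb'
    · exact absurd rfl hab
    · exact hc b hb'
    · exact (hc a ha').symm
    · exact hS2 a ha' b hb' hab)
  rw [Finset.card_insert_of_notMem heS] at h2
  omega

theorem gain_ge (h : IsSkel ρ V r par ω Λ) (hρ : IsPM ρ) (hd : IsDep V r par ω dep)
    (hL : 0 < L) (hτ : 0 < τ) (hτL : 128 * τ ≤ L)
    (hcov : ∀ x, ∃ v ∈ V, ρ x v ≤ τ) {p q : X} (hpq : L / 2 ≤ dist p q)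
    {V1 Λ1 : Finset X} (hV1 : V1 = prune V r par dep L) (hΛ1 : Λ1 = leaves V1 r par) :
    L / 8 ≤ Phi V ω Λ τ - Phi V1 ω Λ1 L := by
  have h1 : IsSkel ρ V1 r par ω Λ1 := by rw [hΛ1, hV1]; exact h.prune_skel hρ hd L
  have hV1V : V1 ⊆ V := by rw [hV1]; exact prune_sub _ _ _ _ _
  have hd1 : IsDep V1 r par ω dep := ⟨hd.root, fun v hv => hd.step v (hV1V hv)⟩
  have hτL' : τ ≤ L := by linarith
  rcases Λ1.eq_empty_or_nonempty with he | hne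
  · have g1 := h.prune_gain (dep := dep) hρ hτL' hL.le
    rw [← hV1, ← hΛ1] at g1
    have hVr : V1 = {r} := h1.leaves_empty hρ hd1 (by rw [← hΛ1]; exact he)
    have key : ∀ v ∈ V, dep v - τ ≤ ∑ u ∈ V \ V1, eff ω Λ τ u := by
      intro v hv
      have hex := h.reach v hv
      have h2 := h.sum_path_le hρ hd hv hτ.le (k := Nat.find hex) (B := V \ V1)
        (fun j hj => Nat.find_min hex hj) Finset.sdiff_subset (by
          intro j hj
          refine Finset.mem_sdiff.2 ⟨h.iter_mem hv j, ?_⟩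
          rw [hVr, Finset.mem_singleton]
          exact Nat.find_min hex hj)
      rw [Nat.find_spec hex, hd.root] at h2
      linarith
    have key2 : ∀ v ∈ V, ρ v r ≤ dep v := by
      intro v hv
      obtain ⟨n, hn⟩ := h.reach v hv
      have := h.ρ_le hρ hd hv n
      rw [hn, hd.root] at this
      linarith
    obtain ⟨v, hv, hpv⟩ := hcov p
    obtain ⟨v', hv', hqv⟩ := hcov q
    have a1 := hρ.dist_le p q
    have a2 := hρ.tri p v q
    have a3 := hρ.tri v r q
    have a4 := hρ.tri r v' q
    have a5 := hρ.symm v' q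
    have a6 := hρ.symm r v'
    linarith [key v hv, key v' hv', key2 v hv, key2 v' hv']
  · have g2 := h.prune_gain_leaves hρ hd hτ.le hτL' hL.le
    rw [← hV1, ← hΛ1] at g2
    have : (1 : ℝ) ≤ Λ1.card := by exact_mod_cast hne.card_pos
    nlinarith

set_option maxHeartbeats 2000000 in
theorem step (h : IsSkel ρ V r par ω Λ) (hρ : IsPM ρ) (hε : 0 < ε) (hε1 : ε < 1)
    (hL : 0 < L) (hτ : τ = ε * L / 128)
    (hcov : ∀ x, ∃ v ∈ V, ρ x v ≤ τ)
    (hM : ∀ Q' ⊆ N, (∀ p ∈ Q', ∀ q ∈ Q', dist p q ≤ 9 * τ) → Q'.card ≤ M)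
    (hME : ∀ p ∈ N, (N.filter fun q => dist p q ≤ 3 * L).card ≤ ME)
    {E : Finset (Sym2 X)}
    (hE : ∀ e ∈ E, ∃ p ∈ N, ∃ q ∈ N, e = s(p, q) ∧ L / 2 ≤ dist p q ∧ dist p q ≤ 3 * L ∧
      (1 + ε / 2) * dist p q < ρ p q)
    (hρ' : IsPM ρ') (hle : ∀ x y, ρ' x y ≤ ρ x y)
    (hE' : ∀ p q, s(p, q) ∈ E → ρ' p q ≤ dist p q) :
    ∃ V' par' ω' Λ', IsSkel ρ' V' r par' ω' Λ' ∧ (∀ x, ∃ v ∈ V', ρ' x v ≤ 8 * L) ∧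
      edgeWeight E ≤ 80000 * ε⁻¹ ^ 2 * (M * ME) * (Phi V ω Λ τ - Phi V' ω' Λ' L) := by
  have hτ0 : 0 < τ := by rw [hτ]; positivity
  have hτL : 128 * τ ≤ L := by rw [hτ]; nlinarith
  have hM0 : (0 : ℝ) ≤ M := by positivity
  have hME0 : (0 : ℝ) ≤ ME := by positivity
  rcases E.eq_empty_or_nonempty with rfl | ⟨e1, he1⟩
  · refine ⟨V, par, ω, Λ, ⟨h.toIsTree, h.ω_root, fun v hv => (hle _ _).trans (h.ω_ge v hv),
      h.Λ_sub, h.Λ_leaf⟩, ?_, ?_⟩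
    · intro x
      obtain ⟨v, hv, hxv⟩ := hcov x
      exact ⟨v, hv, (hle _ _).trans (by linarith)⟩
    · have := IsSkel.Phi_anti V ω Λ (show τ ≤ L by linarith)
      have h2 : 0 ≤ Phi V ω Λ τ - Phi V ω Λ L := by linarith
      simp only [edgeWeight, Finset.sum_empty]
      positivity
  obtain ⟨dep, hd⟩ := h.exists_dep
  obtain ⟨V1, hV1⟩ : ∃ V1, V1 = prune V r par dep L := ⟨_, rfl⟩
  obtain ⟨Λ1, hΛ1⟩ : ∃ Λ1, Λ1 = leaves V1 r par := ⟨_, rfl⟩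
  have h1 : IsSkel ρ V1 r par ω Λ1 := by rw [hΛ1, hV1]; exact h.prune_skel hρ hd L
  have hV1V : V1 ⊆ V := by rw [hV1]; exact prune_sub _ _ _ _ _
  have hd1 : IsDep V1 r par ω dep := ⟨hd.root, fun v hv => hd.step v (hV1V hv)⟩
  obtain ⟨G, hG⟩ : ∃ G, G = Phi V ω Λ τ - Phi V1 ω Λ1 L := ⟨_, rfl⟩
  have hGL : L / 8 ≤ G := by
    obtain ⟨p, _, q, _, _, hpq, _⟩ := hE e1 he1
    rw [hG]
    exact gain_ge h hρ hd hL hτ0 hτL hcov hpq hV1 hΛ1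
  obtain ⟨f, N1, hN1, hgood, hN1c⟩ := first_count h hρ hd hL hτ0 hτL hcov hM hV1 hΛ1 hG hGL
  set Zf : X × X → Finset X := fun e => Zone V1 par dep (6 * L) (f e.1) ∪
    Zone V1 par dep (6 * L) (f e.2) with hZf
  set Q2 : Finset (X × X) := (N ×ˢ N).filter fun e => e.1 ∉ N1 ∧ e.2 ∉ N1 ∧ s(e.1, e.2) ∈ E ∧
    L / 2 ≤ dist e.1 e.2 ∧ dist e.1 e.2 ≤ 3 * L ∧ (1 + ε / 2) * dist e.1 e.2 < ρ e.1 e.2 with hQ2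
  have hQ2' : ∀ e ∈ Q2, e.1 ∈ N ∧ e.2 ∈ N ∧ e.1 ∉ N1 ∧ e.2 ∉ N1 ∧ s(e.1, e.2) ∈ E ∧
    L / 2 ≤ dist e.1 e.2 ∧ dist e.1 e.2 ≤ 3 * L ∧ (1 + ε / 2) * dist e.1 e.2 < ρ e.1 e.2 := by
    intro e he
    obtain ⟨h1, h2⟩ := Finset.mem_filter.1 he
    rw [Finset.mem_product] at h1
    exact ⟨h1.1, h1.2, h2⟩
  have h6 : 0 < 6 * L := by linarith
  obtain ⟨S, hSQ, hSd, hSm⟩ := exists_max_disj Q2 Zf (by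
    intro e he
    obtain ⟨a1, a2, a3, a4, _⟩ := hQ2' e he
    exact ⟨f e.1, Finset.mem_union_left _ (mem_Zone_self (hgood _ a1 a3).1.mem h6)⟩)
  obtain ⟨g, hg⟩ : ∃ g, g = ε * L / 8 := ⟨_, rfl⟩
  have hg0 : 0 < g := by rw [hg]; positivity
  obtain ⟨V', par', ω', Λ', hs⟩ := mods (ρ' := ρ') (g := g) h1 hρ hd1 hρ' hle hL hg0
    (by rw [hg]; nlinarith) (a := fun e : X × X => f e.1) (b := fun e : X × X => f e.2)
    (w := fun e => dist e.1 e.2 + 8 * τ) S hSd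
    (fun e he => by
      obtain ⟨a1, a2, a3, a4, _⟩ := hQ2' e (hSQ he)
      exact (hgood _ a1 a3).1)
    (fun e he => by
      obtain ⟨a1, a2, a3, a4, _⟩ := hQ2' e (hSQ he)
      exact (hgood _ a2 a4).1)
    (fun e he => by
      obtain ⟨a1, a2, a3, a4, a5, _⟩ := hQ2' e (hSQ he)
      have b1 := (hgood _ a1 a3).2
      have b2 := (hgood _ a2 a4).2
      have b3 := hE' _ _ a5
      have b4 := hρ'.tri (f e.1) e.1 (f e.2)
      have b5 := hρ'.tri e.1 e.2 (f e.2)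
      have b6 := hρ'.symm (f e.1) e.1
      have b7 := hle e.1 (f e.1)
      have b8 := hle e.2 (f e.2)
      linarith)
    (fun e he => by
      obtain ⟨a1, a2, a3, a4, a5, a6, a7, _⟩ := hQ2' e (hSQ he)
      linarith)
    (fun e he => by
      obtain ⟨a1, a2, a3, a4, a5, a6, a7, a8⟩ := hQ2' e (hSQ he)
      have b1 := (hgood _ a1 a3).2
      have b2 := (hgood _ a2 a4).2
      have b4 := hρ.tri e.1 (f e.1) e.2
      have b5 := hρ.tri (f e.1) (f e.2) e.2
      have b6 := hρ.symm (f e.2) e.2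
      have b7 : ε * (L / 2) ≤ ε * dist e.1 e.2 := by gcongr
      rw [hτ] at *
      linarith)
  refine ⟨V', par', ω', Λ', hs.skel, ?_, ?_⟩
  · intro x
    obtain ⟨v, hv, hxv⟩ := hcov x
    obtain ⟨n, hn1, hn2⟩ := h.prune_cover (dep := dep) hL.le hv
    rw [← hV1] at hn1
    have c1 := h.ρ_le hρ hd hv n
    have c2 := hρ.tri x v (par^[n] v)
    rcases hs.cover _ hn1 with hc | ⟨v', hv', _, hvv'⟩
    · exact ⟨_, hc, (hle _ _).trans (by linarith)⟩
    · refine ⟨v', hv', (hle _ _).trans ?_⟩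
      have c3 := hρ.tri x (par^[n] v) v'
      linarith
  -- counting
  set P : X → Finset X := fun s => (N \ N1).filter fun p =>
    ¬ Disjoint (Zone V1 par dep (6 * L) (f p)) (Zone V1 par dep (6 * L) s) with hP
  set N2 : Finset X := S.biUnion fun e => P (f e.1) ∪ P (f e.2) with hN2
  have hPc : ∀ s, Good V1 r par Λ1 dep (6 * L) s → ((P s).card : ℝ) ≤ M * (13 * L / τ) := by
    intro s hs
    have := zone_count h1 hρ hd1 h6 hτ0 hM hs (Q := P s)
      ((Finset.filter_subset _ _).trans Finset.sdiff_subset) (f := f) (by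
        intro p hp
        obtain ⟨hp1, _⟩ := Finset.mem_filter.1 hp
        rw [Finset.mem_sdiff] at hp1
        exact (hgood p hp1.1 hp1.2).2) (by
        intro p hp
        obtain ⟨hp1, _⟩ := Finset.mem_filter.1 hp
        rw [Finset.mem_sdiff] at hp1
        exact (hgood p hp1.1 hp1.2).1) (by
        intro p hp
        exact (Finset.mem_filter.1 hp).2)
    refine this.trans ?_
    gcongr
    rw [div_add_one hτ0.ne', div_le_div_iff_of_pos_right hτ0]; linarith
  have hN2c : (N2.card : ℝ) ≤ S.card * (2 * (M * (13 * L / τ))) := by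
    have c1 : (N2.card : ℝ) ≤ ∑ e ∈ S, ((P (f e.1) ∪ P (f e.2)).card : ℝ) := by
      exact_mod_cast Finset.card_biUnion_le
    refine c1.trans ?_
    rw [← nsmul_eq_mul]
    apply Finset.sum_le_card_nsmul
    intro e he
    obtain ⟨a1, a2, a3, a4, _⟩ := hQ2' e (hSQ he)
    have c2 : ((P (f e.1) ∪ P (f e.2)).card : ℝ) ≤ (P (f e.1)).card + (P (f e.2)).card := by
      exact_mod_cast Finset.card_union_le _ _
    have c3 := hPc _ (hgood _ a1 a3).1
    have c4 := hPc _ (hgood _ a2 a4).1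
    linarith
  have hend : ∀ p ∈ N, ∀ q ∈ N, s(p, q) ∈ E → L / 2 ≤ dist p q → dist p q ≤ 3 * L →
      (1 + ε / 2) * dist p q < ρ p q → p ∈ N1 ∪ N2 ∨ q ∈ N1 ∪ N2 := by
    intro p hp q hq hpq d1 d2 d3
    by_contra hc
    push Not at hc
    rw [Finset.mem_union, Finset.mem_union] at hc
    push Not at hc
    obtain ⟨⟨p1, p2⟩, q1, q2⟩ := hc
    obtain ⟨e', he', hdj⟩ := hSm (p, q) (Finset.mem_filter.2
      ⟨Finset.mem_product.2 ⟨hp, hq⟩, p1, q1, hpq, d1, d2, d3⟩)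
    obtain ⟨u, hu, hu'⟩ := Finset.not_disjoint_iff.1 hdj
    have gen : ∀ z ∈ N, z ∉ N1 → u ∈ Zone V1 par dep (6 * L) (f z) → z ∈ N2 := by
      intro z hz hz1 huz
      refine Finset.mem_biUnion.2 ⟨e', he', ?_⟩
      rcases Finset.mem_union.1 hu' with hu1 | hu1
      · exact Finset.mem_union_left _ (Finset.mem_filter.2 ⟨Finset.mem_sdiff.2 ⟨hz, hz1⟩,
          Finset.not_disjoint_iff.2 ⟨u, huz, hu1⟩⟩)
      · exact Finset.mem_union_right _ (Finset.mem_filter.2 ⟨Finset.mem_sdiff.2 ⟨hz, hz1⟩,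
          Finset.not_disjoint_iff.2 ⟨u, huz, hu1⟩⟩)
    rcases Finset.mem_union.1 hu with hu1 | hu1
    · exact p2 (gen p hp p1 hu1)
    · exact q2 (gen q hq q1 hu1)
  have hN2N : N2 ⊆ N := by
    intro z hz
    obtain ⟨e, _, hz⟩ := Finset.mem_biUnion.1 hz
    rcases Finset.mem_union.1 hz with hz | hz
    · exact (Finset.mem_sdiff.1 (Finset.mem_filter.1 hz).1).1
    · exact (Finset.mem_sdiff.1 (Finset.mem_filter.1 hz).1).1
  have hEsub : E ⊆ (N1 ∪ N2).biUnion fun p =>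
      (N.filter fun q => dist p q ≤ 3 * L).image fun q => s(p, q) := by
    intro e he
    obtain ⟨p, hp, q, hq, rfl, d1, d2, d3⟩ := hE e he
    rcases hend p hp q hq he d1 d2 d3 with hc | hc
    · exact Finset.mem_biUnion.2 ⟨p, hc, Finset.mem_image.2 ⟨q, Finset.mem_filter.2 ⟨hq, d2⟩, rfl⟩⟩
    · exact Finset.mem_biUnion.2 ⟨q, hc, Finset.mem_image.2
        ⟨p, Finset.mem_filter.2 ⟨hp, by rw [dist_comm]; exact d2⟩, Sym2.eq_swap⟩⟩
  have hEc : (E.card : ℝ) ≤ (N1.card + N2.card) * ME := by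
    have c1 : E.card ≤ (N1 ∪ N2).card * ME := by
      refine (Finset.card_le_card hEsub).trans (Finset.card_biUnion_le_card_mul _ _ _ ?_)
      intro p hp
      refine Finset.card_image_le.trans (hME p ?_)
      exact (Finset.union_subset hN1 hN2N) hp
    have c2 := Finset.card_union_le N1 N2
    have c3 : E.card ≤ (N1.card + N2.card) * ME := c1.trans (Nat.mul_le_mul_right _ c2)
    exact_mod_cast c3
  have hw : edgeWeight E ≤ E.card * (3 * L) := by
    rw [← nsmul_eq_mul]
    apply Finset.sum_le_card_nsmul
    intro e he
    obtain ⟨p, hp, q, hq, rfl, d1, d2, d3⟩ := hE e he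
    exact d2
  have hphi := hs.phi
  set G2 := Phi V1 ω Λ1 L - Phi V' ω' Λ' L with hG2
  have hSG : (S.card : ℝ) * g ≤ G2 := by linarith
  have hG20 : 0 ≤ G2 := le_trans (by positivity) hSG
  have hN2d : (N2.card : ℝ) ≤ M * (208 * G2 / (ε * τ)) := by
    have : (S.card : ℝ) ≤ 8 * G2 / (ε * L) := by
      rw [le_div_iff₀ (by positivity)]
      rw [hg] at hSG; linarith
    calc (N2.card : ℝ) ≤ S.card * (2 * (M * (13 * L / τ))) := hN2c
      _ ≤ (8 * G2 / (ε * L)) * (2 * (M * (13 * L / τ))) := by gcongr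
      _ = M * (208 * G2 / (ε * τ)) := by field_simp; ring
  have hG0 : 0 ≤ G := by linarith
  have hN1d : (N1.card : ℝ) ≤ M * (208 * G / (ε * τ)) := by
    refine hN1c.trans ?_
    gcongr
    · norm_num
    · nlinarith
  have htot : Phi V ω Λ τ - Phi V' ω' Λ' L = G + G2 := by rw [hG, hG2]; ring
  rw [htot]
  calc edgeWeight E ≤ E.card * (3 * L) := hw
    _ ≤ ((M * (208 * G / (ε * τ)) + M * (208 * G2 / (ε * τ))) * ME) * (3 * L) := by
        gcongr
        exact hEc.trans (by gcongr)
    _ = 79872 * ε⁻¹ ^ 2 * (M * ME) * (G + G2) := by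
        rw [hτ]; field_simp; ring
    _ ≤ 80000 * ε⁻¹ ^ 2 * (M * ME) * (G + G2) := by gcongr; norm_num

end
end LightSpanner

noncomputable section LightSpanner
open scoped Classical
set_option linter.unusedSectionVars false

/-! ### Assembling the spanner -/

section
variable {X : Type u} [MetricSpace X]

theorem sym2Dist_nonneg (e : Sym2 X) : 0 ≤ sym2Dist e := by
  induction e using Sym2.ind with
  | _ x y => exact dist_nonneg (x := x) (y := y)

theorem edgeWeight_nonneg (E : Finset (Sym2 X)) : 0 ≤ edgeWeight E :=
  Finset.sum_nonneg fun e _ => sym2Dist_nonneg e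

theorem edgeWeight_union (E F : Finset (Sym2 X)) :
    edgeWeight (E ∪ F) ≤ edgeWeight E + edgeWeight F := by
  have h1 := Finset.sum_union_inter (s₁ := E) (s₂ := F) (f := sym2Dist)
  have h2 := edgeWeight_nonneg (E ∩ F)
  unfold edgeWeight at *
  linarith

theorem edgeWeight_biUnion {ι : Type*} (s : Finset ι) (H : ι → Finset (Sym2 X)) {W : ℝ}
    (hW : ∀ i ∈ s, edgeWeight (H i) ≤ W) : edgeWeight (s.biUnion H) ≤ s.card * W := by
  induction s using Finset.induction_on with
  | empty => simp [edgeWeight]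
  | insert a s ha ih =>
    rw [Finset.biUnion_insert, Finset.card_insert_of_notMem ha]
    have h1 := edgeWeight_union (H a) (s.biUnion H)
    have h2 := ih fun i hi => hW i (Finset.mem_insert_of_mem hi)
    have h3 := hW a (Finset.mem_insert_self _ _)
    push_cast
    linarith

/-- The invariant of the level-by-level construction. -/
structure ClassInv [Fintype X] (H0 : Finset (Sym2 X)) (r : X) (ε K W L0 b : ℝ) (n : ℕ)
    (H : Finset (Sym2 X)) : Prop where
  sub : H0 ⊆ H
  edges : IsEdgeSetOn (Finset.univ : Finset X) H
  stretch : ∀ i < n, ∀ x y : X, L0 * b ^ i ≤ dist x y → dist x y < 2 * (L0 * b ^ i) →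
    ∃ p q : X, dist x p ≤ ε * (L0 * b ^ i) / 128 ∧ dist y q ≤ ε * (L0 * b ^ i) / 128 ∧
      pd H p q ≤ (1 + ε / 2) * dist p q
  skel : ∃ V par ω Λ, IsSkel (pd H) V r par ω Λ ∧
    (∀ x, ∃ v ∈ V, pd H x v ≤ ε * (L0 * b ^ n) / 128) ∧
    edgeWeight H + K * Phi V ω Λ (ε * (L0 * b ^ n) / 128) ≤ (1 + K) * W

theorem class_step [Fintype X] {d : ℕ} (hD : Doubling X d) {H0 : Finset (Sym2 X)} (hH0 : Conn H0)
    {r : X} {ε K W L0 : ℝ} {J : ℕ} (hε : 0 < ε) (hε1 : ε < 1) (hJ : 1024 / ε ≤ 2 ^ J)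
    (hL0 : 0 < L0) (hK : K = 80000 * ε⁻¹ ^ 2 * (((2 ^ (5 * d) : ℕ) : ℝ) * ((2 ^ (J * d) : ℕ) : ℝ)))
    {n : ℕ} {H : Finset (Sym2 X)} (hI : ClassInv H0 r ε K W L0 (2 ^ J) n H) :
    ∃ H', ClassInv H0 r ε K W L0 (2 ^ J) (n + 1) H' := by
  obtain ⟨L, hL⟩ : ∃ L, L = L0 * (2 ^ J : ℝ) ^ n := ⟨_, rfl⟩
  obtain ⟨τ, hτ⟩ : ∃ τ, τ = ε * L / 128 := ⟨_, rfl⟩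
  have hLp : 0 < L := by rw [hL]; positivity
  have hτp : 0 < τ := by rw [hτ]; positivity
  have hτL : 128 * τ ≤ L := by rw [hτ]; nlinarith
  obtain ⟨V, par, ω, Λ, hsk, hcov, hwt⟩ := hI.skel
  rw [← hL, ← hτ] at hcov hwt
  have hC : Conn H := hH0.mono hI.sub
  obtain ⟨N, hN1, hN2⟩ := exists_net (X := X) hτp.le
  set E : Finset (Sym2 X) := ((N ×ˢ N).filter fun e => L / 2 ≤ dist e.1 e.2 ∧
    dist e.1 e.2 ≤ 3 * L ∧ (1 + ε / 2) * dist e.1 e.2 < pd H e.1 e.2).image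
      (fun e => s(e.1, e.2)) with hE
  have hE1 : ∀ e ∈ E, ∃ p ∈ N, ∃ q ∈ N, e = s(p, q) ∧ L / 2 ≤ dist p q ∧ dist p q ≤ 3 * L ∧
      (1 + ε / 2) * dist p q < pd H p q := by
    intro e he
    obtain ⟨⟨p, q⟩, hpq, rfl⟩ := Finset.mem_image.1 he
    obtain ⟨h1, h2⟩ := Finset.mem_filter.1 hpq
    rw [Finset.mem_product] at h1
    exact ⟨p, h1.1, q, h1.2, rfl, h2⟩
  have hsub : H ⊆ H ∪ E := Finset.subset_union_left
  have hC' : Conn (H ∪ E) := hC.mono hsub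
  have hM : ∀ Q' ⊆ N, (∀ p ∈ Q', ∀ q ∈ Q', dist p q ≤ 9 * τ) → Q'.card ≤ 2 ^ (5 * d) := by
    intro Q hQ hpq
    rcases Q.eq_empty_or_nonempty with rfl | ⟨x, hx⟩
    · simp
    · apply packing hD (s := τ / 2) (by linarith) 5 x Q
      · intro p hp
        have := hpq p hp x hx
        linarith
      · intro p hp q hq hne
        have := hN1 p (hQ hp) q (hQ hq) hne
        linarith
  have hME : ∀ p ∈ N, (N.filter fun q => dist p q ≤ 3 * L).card ≤ 2 ^ (J * d) := by
    intro p _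
    apply packing hD (s := τ / 2) (by linarith) J p
    · intro q hq
      have h1 := (Finset.mem_filter.1 hq).2
      rw [dist_comm]
      refine h1.trans ?_
      have h2 : 1024 / ε * (τ / 2) ≤ 2 ^ J * (τ / 2) := by gcongr
      have h3 : 1024 / ε * (τ / 2) = 4 * L := by rw [hτ]; field_simp; norm_num
      linarith
    · intro a ha b hb hne
      have := hN1 a (Finset.mem_filter.1 ha).1 b (Finset.mem_filter.1 hb).1 hne
      linarith
  obtain ⟨V', par', ω', Λ', hsk', hcov', hwt'⟩ := step hsk hC.isPM hε hε1 hLp hτ hcov hM hME hE1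
    hC'.isPM (fun x y => hC.pd_mono hsub x y)
    (fun p q hpq => pd_edge (Finset.mem_union_right _ hpq))
  rw [← hK] at hwt'
  have hnext : L0 * (2 ^ J : ℝ) ^ (n + 1) = 2 ^ J * L := by rw [hL]; ring
  have hτn : 8 * L ≤ ε * (2 ^ J * L) / 128 := by
    have h2 : 1024 / ε * (ε * L) ≤ 2 ^ J * (ε * L) := by gcongr
    have h3 : 1024 / ε * (ε * L) = 1024 * L := by field_simp
    linarith
  have hK0 : 0 ≤ K := by rw [hK]; positivity
  refine ⟨H ∪ E, hI.sub.trans hsub, ?_, ?_, V', par', ω', Λ', hsk', ?_, ?_⟩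
  · intro e he
    rcases Finset.mem_union.1 he with he | he
    · exact hI.edges e he
    · obtain ⟨p, _, q, _, rfl, h1, _⟩ := hE1 e he
      refine ⟨?_, fun x _ => Finset.mem_univ x⟩
      rw [Sym2.mk_isDiag_iff]
      rintro rfl
      rw [dist_self] at h1
      linarith
  · intro i hi x y h1 h2
    rcases Nat.lt_succ_iff_lt_or_eq.1 hi with hi | rfl
    · obtain ⟨p, q, a1, a2, a3⟩ := hI.stretch i hi x y h1 h2
      exact ⟨p, q, a1, a2, (hC.pd_mono hsub p q).trans a3⟩
    · rw [← hL] at h1 h2 ⊢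
      rw [← hτ]
      obtain ⟨p, hp, hxp⟩ := hN2 x
      obtain ⟨q, hq, hyq⟩ := hN2 y
      refine ⟨p, q, hxp, hyq, ?_⟩
      by_cases hc : pd H p q ≤ (1 + ε / 2) * dist p q
      · exact (hC.pd_mono hsub p q).trans hc
      · push Not at hc
        have t1 := dist_triangle x p y
        have t2 := dist_triangle p q y
        have t3 := dist_triangle p x q
        have t4 := dist_triangle x y q
        rw [dist_comm q y] at t2
        rw [dist_comm p x] at t3
        have hmem : s(p, q) ∈ E := Finset.mem_image.2 ⟨(p, q), Finset.mem_filter.2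
          ⟨Finset.mem_product.2 ⟨hp, hq⟩, by simp only; linarith, by simp only; linarith, hc⟩, rfl⟩
        have := pd_edge (Finset.mem_union_right H hmem)
        have hd0 : 0 ≤ dist p q := dist_nonneg
        nlinarith
  · intro x
    obtain ⟨v, hv, hxv⟩ := hcov' x
    exact ⟨v, hv, by rw [hnext]; linarith⟩
  · rw [hnext]
    have h1 := edgeWeight_union H E
    have h2 := IsSkel.Phi_anti V' ω' Λ' (show L ≤ ε * (2 ^ J * L) / 128 by linarith)
    have h3 := mul_le_mul_of_nonneg_left h2 hK0
    linarith

theorem class_all [Fintype X] {d : ℕ} (hD : Doubling X d) {H0 : Finset (Sym2 X)} (hH0 : Conn H0)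
    {r : X} {ε K W L0 : ℝ} {J : ℕ} (hε : 0 < ε) (hε1 : ε < 1) (hJ : 1024 / ε ≤ 2 ^ J)
    (hL0 : 0 < L0) (hK : K = 80000 * ε⁻¹ ^ 2 * (((2 ^ (5 * d) : ℕ) : ℝ) * ((2 ^ (J * d) : ℕ) : ℝ)))
    (h0 : ClassInv H0 r ε K W L0 (2 ^ J) 0 H0) (n : ℕ) :
    ∃ H, ClassInv H0 r ε K W L0 (2 ^ J) n H := by
  induction n with
  | zero => exact ⟨H0, h0⟩
  | succ n ih =>
    obtain ⟨H, hH⟩ := ih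
    exact class_step hD hH0 hε hε1 hJ hL0 hK hH

/-- A rooted spanning tree inside a connected edge set. -/
theorem exists_tree [Fintype X] {H : Finset (Sym2 X)} (hH : Conn H) (r : X) :
    ∃ par : X → X, IsTree Finset.univ r par ∧ (∀ v, v ≠ r → s(v, par v) ∈ H) ∧
      Set.InjOn (fun v => s(v, par v)) {v | v ≠ r} := by
  have hpath : ∀ x : X, ∃ n : ℕ, ∃ l : List X, l.length = n ∧ IsPathIn H x r l := by
    intro x
    by_contra hc
    push Not at hc
    have h1 := hH x r
    have : pathDist H x r = ⊤ := by
      unfold pathDist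
      simp only [iInf_eq_top]
      intro l hl
      exact absurd hl (hc l.length l rfl)
    rw [this] at h1
    exact lt_irrefl _ h1
  set lev : X → ℕ := fun x => Nat.find (hpath x) with hlev
  have hstep : ∀ x, x ≠ r → ∃ y, s(x, y) ∈ H ∧ lev y < lev x := by
    intro x hx
    obtain ⟨l, hl1, hl2⟩ := Nat.find_spec (hpath x)
    rcases l with _ | ⟨y, l⟩
    · exact absurd hl2.nil_inv hx
    · obtain ⟨h1, h2⟩ := hl2.cons_inv
      refine ⟨y, h1, ?_⟩
      have h3 : lev y ≤ l.length := Nat.find_min' (hpath y) ⟨l, rfl, h2⟩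
      have h4 : lev x = l.length + 1 := by rw [← List.length_cons (a := y)]; exact hl1.symm
      omega
  choose! f hf1 hf2 using hstep
  set par : X → X := fun x => if x = r then r else f x with hpar
  have hp : ∀ x, x ≠ r → par x = f x := fun x hx => by simp [hpar, hx]
  refine ⟨par, ⟨Finset.mem_univ _, by simp [hpar], fun _ _ => Finset.mem_univ _, ?_⟩, ?_, ?_⟩
  · have key : ∀ m : ℕ, ∀ x, lev x ≤ m → ∃ n : ℕ, par^[n] x = r := by
      intro m
      induction m with
      | zero =>
        intro x hx
        by_cases hxr : x = r
        · exact ⟨0, hxr⟩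
        · have := hf2 x hxr; omega
      | succ m ih =>
        intro x hx
        by_cases hxr : x = r
        · exact ⟨0, hxr⟩
        · have := hf2 x hxr
          obtain ⟨n, hn⟩ := ih (f x) (by omega)
          exact ⟨n + 1, by rw [Function.iterate_succ_apply, hp x hxr, hn]⟩
    intro x _
    exact key _ x le_rfl
  · intro v hv
    rw [hp v hv]; exact hf1 v hv
  · intro u hu v hv huv
    simp only [Set.mem_setOf_eq] at hu hv
    simp only [hp u hu, hp v hv, Sym2.eq_iff] at huv
    rcases huv with h | ⟨h1, h2⟩
    · exact h.1
    · have a1 := hf2 u hu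
      have a2 := hf2 v hv
      rw [h2] at a1
      rw [← h1] at a2
      omega

theorem start_inv [Fintype X] {H0 : Finset (Sym2 X)} (hH0 : Conn H0)
    (hE : IsEdgeSetOn (Finset.univ : Finset X) H0)
    (r : X) {ε K L0 b : ℝ} (hε : 0 < ε) (hL0 : 0 < L0) (hK : 0 ≤ K) :
    ClassInv H0 r ε K (edgeWeight H0) L0 b 0 H0 := by
  obtain ⟨par, htree, hpar, hinj⟩ := exists_tree hH0 r
  refine ⟨subset_rfl, hE, fun i hi => absurd hi (Nat.not_lt_zero i), Finset.univ, par,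
    fun v => dist v (par v), ∅, ⟨htree, ?_, ?_, ?_, ?_⟩, ?_, ?_⟩
  · simp only [htree.par_root, dist_self]
  · intro v _
    by_cases hv : v = r
    · subst hv; rw [htree.par_root, hH0.isPM.self, dist_self]
    · exact pd_edge (hpar v hv)
  · simp
  · simp
  · intro x
    refine ⟨x, Finset.mem_univ _, ?_⟩
    rw [hH0.isPM.self]
    positivity
  · have h1 : Phi Finset.univ (fun v => dist v (par v)) ∅ (ε * (L0 * b ^ 0) / 128) ≤
        edgeWeight H0 := by
      have e1 : Phi Finset.univ (fun v => dist v (par v)) ∅ (ε * (L0 * b ^ 0) / 128) =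
          ∑ v ∈ Finset.univ.erase r, sym2Dist s(v, par v) := by
        rw [Phi, ← Finset.sum_erase_add _ _ (Finset.mem_univ r)]
        have : eff (fun v => dist v (par v)) ∅ (ε * (L0 * b ^ 0) / 128) r = 0 := by
          simp [eff, htree.par_root]
        rw [this, add_zero]
        apply Finset.sum_congr rfl
        intro v _
        simp [eff, sym2Dist]
      rw [e1, ← Finset.sum_image (f := sym2Dist) (g := fun v => s(v, par v))]
      · apply Finset.sum_le_sum_of_subset_of_nonneg
        · intro e he
          obtain ⟨v, hv, rfl⟩ := Finset.mem_image.1 he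
          exact hpar v (Finset.ne_of_mem_erase hv)
        · intro e _ _
          exact sym2Dist_nonneg e
      · intro u hu v hv huv
        exact hinj (Finset.ne_of_mem_erase hu) (Finset.ne_of_mem_erase hv) huv
    have := mul_le_mul_of_nonneg_left h1 hK
    linarith

theorem exists_mst [Fintype X] : ∃ H0 : Finset (Sym2 X),
    IsEdgeSetOn (Finset.univ : Finset X) H0 ∧ Conn H0 ∧
      mstw (Finset.univ : Finset X) = edgeWeight H0 := by
  have hne : {w : ℝ | ∃ E : Finset (Sym2 X), IsEdgeSetOn Finset.univ E ∧
    (∀ x ∈ (Finset.univ : Finset X), ∀ y ∈ (Finset.univ : Finset X), pathDist E x y < ⊤) ∧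
      w = edgeWeight E}.Nonempty := by
    refine ⟨_, Finset.univ.filter (fun e : Sym2 X => ¬ e.IsDiag), ?_, ?_, rfl⟩
    · intro e he
      exact ⟨(Finset.mem_filter.1 he).2, fun x _ => Finset.mem_univ x⟩
    · intro x _ y _
      by_cases hxy : x = y
      · subst hxy; rw [pathDist_self]; simp
      · refine (pathDist_edge (Finset.mem_filter.2 ⟨Finset.mem_univ _, ?_⟩)).trans_lt
          ENNReal.ofReal_lt_top
        rw [Sym2.mk_isDiag_iff]; exact hxy
  have hfin : {w : ℝ | ∃ E : Finset (Sym2 X), IsEdgeSetOn Finset.univ E ∧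
    (∀ x ∈ (Finset.univ : Finset X), ∀ y ∈ (Finset.univ : Finset X), pathDist E x y < ⊤) ∧
      w = edgeWeight E}.Finite := by
    apply (Set.finite_range (fun E : Finset (Sym2 X) => edgeWeight E)).subset
    rintro w ⟨E, _, _, rfl⟩
    exact ⟨E, rfl⟩
  obtain ⟨E, h1, h2, h3⟩ := hne.csInf_mem hfin
  exact ⟨E, h1, fun x y => h2 x (Finset.mem_univ _) y (Finset.mem_univ _), h3⟩

theorem exists_min_dist [Fintype X] : ∃ L : ℝ, 0 < L ∧ ∀ x y : X, x ≠ y → L ≤ dist x y := by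
  set s := (Finset.univ : Finset (X × X)).filter fun e => e.1 ≠ e.2 with hs
  rcases s.eq_empty_or_nonempty with he | hne
  · refine ⟨1, one_pos, fun x y hxy => ?_⟩
    have : (x, y) ∈ s := Finset.mem_filter.2 ⟨Finset.mem_univ _, hxy⟩
    rw [he] at this; simp at this
  · obtain ⟨e, he, hmin⟩ := Finset.exists_min_image s (fun e => dist e.1 e.2) hne
    refine ⟨dist e.1 e.2, dist_pos.2 (Finset.mem_filter.1 he).2, fun x y hxy => ?_⟩
    exact hmin (x, y) (Finset.mem_filter.2 ⟨Finset.mem_univ _, hxy⟩)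

theorem exists_max_dist [Fintype X] {L : ℝ} (hL : 0 < L) :
    ∃ n : ℕ, ∀ x y : X, dist x y < L * 2 ^ n := by
  obtain ⟨n, hn⟩ := pow_unbounded_of_one_lt ((∑ e : X × X, dist e.1 e.2) / L)
    (one_lt_two : (1 : ℝ) < 2)
  refine ⟨n, fun x y => ?_⟩
  rw [div_lt_iff₀ hL] at hn
  have := Finset.single_le_sum (f := fun e : X × X => dist e.1 e.2)
    (fun e _ => dist_nonneg) (Finset.mem_univ (x, y))
  simp only at this
  linarith

theorem spanner_core [Fintype X] [Nonempty X] {d : ℕ} (hD : Doubling X d) {ε K : ℝ} {J : ℕ}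
    (hε : 0 < ε) (hε1 : ε < 1) (hJ : 1024 / ε ≤ 2 ^ J)
    (hK : K = 80000 * ε⁻¹ ^ 2 * (((2 ^ (5 * d) : ℕ) : ℝ) * ((2 ^ (J * d) : ℕ) : ℝ))) :
    ∃ S : Finset (Sym2 X), IsEdgeSetOn (Finset.univ : Finset X) S ∧
      (∀ x y : X, pathDist S x y ≤ ENNReal.ofReal ((1 + ε) * dist x y)) ∧
      edgeWeight S ≤ J * ((1 + K) * mstw (Finset.univ : Finset X)) := by
  obtain ⟨H0, hE0, hC0, hw0⟩ := exists_mst (X := X)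
  obtain ⟨Lm, hLm, hLmin⟩ := exists_min_dist (X := X)
  obtain ⟨n, hn⟩ := exists_max_dist (X := X) hLm
  have hK0 : 0 ≤ K := by rw [hK]; positivity
  obtain ⟨r⟩ := ‹Nonempty X›
  have hcl : ∀ j : ℕ, ∃ H, ClassInv H0 r ε K (edgeWeight H0) (Lm * 2 ^ j) (2 ^ J) n H := fun j =>
    class_all hD hC0 hε hε1 hJ (by positivity) hK
      (start_inv hC0 hE0 r hε (by positivity) hK0) n
  choose H hH using hcl
  have hJ0 : 0 < J := by
    by_contra h0
    have h1 : J = 0 := by omega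
    subst h1
    have : 1024 ≤ 1024 / ε := by rw [le_div_iff₀ hε]; linarith
    norm_num at hJ
    linarith
  set S := (Finset.range J).biUnion H with hS
  have hsub : ∀ j < J, H j ⊆ S := fun j hj =>
    Finset.subset_biUnion_of_mem H (Finset.mem_range.2 hj)
  have hCj : ∀ j, Conn (H j) := fun j => hC0.mono (hH j).sub
  have hCS : Conn S := (hCj 0).mono (hsub 0 hJ0)
  have hpm := hCS.isPM
  have key : ∀ m ≤ n, ∀ x y : X, dist x y < Lm * 2 ^ m → pd S x y ≤ (1 + ε) * dist x y := by
    intro m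
    induction m with
    | zero =>
      intro _ x y hxy
      have : x = y := by
        by_contra hc
        have := hLmin x y hc
        simp at hxy; linarith
      subst this
      rw [hpm.self, dist_self, mul_zero]
    | succ m ih =>
      intro hm x y hxy
      rcases lt_or_ge (dist x y) (Lm * 2 ^ m) with hlt | hge
      · exact ih (by omega) x y hlt
      · have hj : m % J < J := Nat.mod_lt _ hJ0
        have hi : m / J < n := lt_of_le_of_lt (Nat.div_le_self _ _) (by omega)
        have hL : Lm * 2 ^ (m % J) * (2 ^ J) ^ (m / J) = Lm * (2 : ℝ) ^ m := by
          rw [mul_assoc, ← pow_mul, ← pow_add, Nat.mod_add_div]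
        have hst := (hH (m % J)).stretch (m / J) hi x y
        rw [hL] at hst
        obtain ⟨p, q, hxp, hyq, hpq⟩ := hst hge (by rw [pow_succ] at hxy; linarith)
        set L := Lm * (2 : ℝ) ^ m with hLdef
        have hLp : 0 < L := by positivity
        have hsm : ε * L / 128 < L := by nlinarith
        have a1 := ih (by omega) x p (lt_of_le_of_lt hxp hsm)
        have a2 := ih (by omega) y q (lt_of_le_of_lt hyq hsm)
        have a3 := ((hCj (m % J)).pd_mono (hsub _ hj) p q).trans hpq
        have b1 := hpm.tri x p y
        have b2 := hpm.tri p q y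
        rw [hpm.symm q y] at b2
        have t3 := dist_triangle p x q
        have t4 := dist_triangle x y q
        rw [dist_comm p x] at t3
        have c1 : (1 + ε) * dist x p ≤ 2 * (ε * L / 128) := by
          have : 0 ≤ dist x p := dist_nonneg
          nlinarith
        have c2 : (1 + ε) * dist y q ≤ 2 * (ε * L / 128) := by
          have : 0 ≤ dist y q := dist_nonneg
          nlinarith
        have c3 : (1 + ε / 2) * dist p q ≤ (1 + ε / 2) * (dist x y + 2 * (ε * L / 128)) := by
          gcongr; linarith
        have c4 : ε * L ≤ ε * dist x y := by gcongr
        have c5 : ε / 2 * (2 * (ε * L / 128)) ≤ 1 / 2 * (2 * (ε * L / 128)) := by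
          gcongr
        nlinarith
  refine ⟨S, ?_, fun x y => hCS.pathDist_le_of_pd (key n le_rfl x y (hn x y)), ?_⟩
  · intro e he
    obtain ⟨j, _, hj⟩ := Finset.mem_biUnion.1 he
    exact (hH j).edges e hj
  · have := edgeWeight_biUnion (Finset.range J) H (W := (1 + K) * mstw (Finset.univ : Finset X)) (by
      intro j _
      obtain ⟨V, par, ω, Λ, hsk, _, hwt⟩ := (hH j).skel
      have h1 := hsk.Phi_nonneg (hCj j).isPM (ε * (Lm * 2 ^ j * (2 ^ J) ^ n) / 128)
      have h2 := mul_nonneg hK0 h1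
      rw [hw0]
      linarith)
    rwa [Finset.card_range] at this

end

theorem spanner_final (d : ℕ) :
    ∃ C : ℝ, 0 < C ∧
      ∀ (X : Type u) [MetricSpace X] [Fintype X], 2 ≤ Fintype.card X → Doubling X d →
        ∀ ε : ℝ, 0 < ε → ε < 1 →
          ∃ S : Finset (Sym2 X), IsEdgeSetOn (Finset.univ : Finset X) S ∧
            (∀ x y : X, pathDist S x y ≤ ENNReal.ofReal ((1 + ε) * dist x y)) ∧
            edgeWeight S ≤
              C * ε⁻¹ ^ (d + 2) * Real.log (2 + ε⁻¹) * mstw (Finset.univ : Finset X) := by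
  refine ⟨13 * (1 + 80000 * 2 ^ (5 * d) * 2048 ^ d), by positivity, ?_⟩
  intro X _ _ hcard hD ε hε hε1
  have hne : Nonempty X := Fintype.card_pos_iff.1 (by omega)
  have hinv : 1 ≤ ε⁻¹ := (one_le_inv₀ hε).2 hε1.le
  obtain ⟨m, hm1, hm2⟩ := exists_nat_pow_near (x := 1024 * ε⁻¹) (y := (2 : ℝ)) (by linarith)
    one_lt_two
  obtain ⟨J, hJdef⟩ : ∃ J, J = m + 1 := ⟨_, rfl⟩
  rw [← hJdef] at hm2
  have hJ2 : (2 : ℝ) ^ J ≤ 2048 * ε⁻¹ := by rw [hJdef, pow_succ]; linarith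
  obtain ⟨S, hS1, hS2, hS3⟩ := spanner_core hD hε hε1 (J := J)
    (by rw [div_eq_mul_inv]; exact hm2.le) rfl
  refine ⟨S, hS1, hS2, hS3.trans ?_⟩
  have hmst : 0 ≤ mstw (Finset.univ : Finset X) := by
    obtain ⟨H0, _, _, h⟩ := exists_mst (X := X)
    rw [h]; exact edgeWeight_nonneg _
  have hlog1 : 1 ≤ Real.log (2 + ε⁻¹) := by
    rw [Real.le_log_iff_exp_le (by positivity)]
    have := Real.exp_one_lt_d9
    linarith
  have hlog : (J : ℝ) ≤ 13 * Real.log (2 + ε⁻¹) := by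
    have h1 := Real.log_le_log (by positivity) hJ2
    rw [Real.log_pow, Real.log_mul (by norm_num) (by positivity)] at h1
    have h2 : Real.log 2048 = 11 * Real.log 2 := by
      rw [show (2048 : ℝ) = 2 ^ 11 by norm_num, Real.log_pow]; norm_num
    have h3 : Real.log ε⁻¹ ≤ Real.log (2 + ε⁻¹) :=
      Real.log_le_log (by positivity) (by linarith)
    have h4 := Real.log_two_gt_d9
    rw [h2] at h1
    have h5 : 0 < Real.log 2 := by linarith
    have h6 : (J : ℝ) * Real.log 2 ≤ (13 * Real.log (2 + ε⁻¹)) * Real.log 2 := by nlinarith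
    exact le_of_mul_le_mul_right h6 h5
  have hpow : ((2 ^ (J * d) : ℕ) : ℝ) ≤ 2048 ^ d * ε⁻¹ ^ d := by
    push_cast
    rw [pow_mul, ← mul_pow]
    gcongr
  have hone : 1 ≤ ε⁻¹ ^ (d + 2) := one_le_pow₀ hinv
  have hKle : 1 + 80000 * ε⁻¹ ^ 2 * (((2 ^ (5 * d) : ℕ) : ℝ) * ((2 ^ (J * d) : ℕ) : ℝ)) ≤
      (1 + 80000 * 2 ^ (5 * d) * 2048 ^ d) * ε⁻¹ ^ (d + 2) := by
    calc 1 + 80000 * ε⁻¹ ^ 2 * (((2 ^ (5 * d) : ℕ) : ℝ) * ((2 ^ (J * d) : ℕ) : ℝ))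
        ≤ ε⁻¹ ^ (d + 2) + 80000 * ε⁻¹ ^ 2 * (((2 ^ (5 * d) : ℕ) : ℝ) * (2048 ^ d * ε⁻¹ ^ d)) := by
          gcongr
      _ = (1 + 80000 * 2 ^ (5 * d) * 2048 ^ d) * ε⁻¹ ^ (d + 2) := by
          push_cast; ring
  calc (J : ℝ) * ((1 + 80000 * ε⁻¹ ^ 2 * (((2 ^ (5 * d) : ℕ) : ℝ) * ((2 ^ (J * d) : ℕ) : ℝ))) *
        mstw (Finset.univ : Finset X))
      ≤ (13 * Real.log (2 + ε⁻¹)) * (((1 + 80000 * 2 ^ (5 * d) * 2048 ^ d) * ε⁻¹ ^ (d + 2)) *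
        mstw (Finset.univ : Finset X)) := by gcongr
    _ = _ := by ring

end LightSpanner

/-- Theorem 5: metrics of doubling dimension d ≥ 1 have (1+ε)-spanners with lightness
Õ(ε^{-(d+2)}). -/
theorem doubling_metric_light_spanner (d : ℕ) (hd : 1 ≤ d) :
    ∃ C : ℝ, 0 < C ∧
      ∀ (X : Type u) [MetricSpace X] [Fintype X], 2 ≤ Fintype.card X →
        (∀ (x : X) (r : ℝ), 0 < r →
          ∃ F : Finset X, F.card ≤ 2 ^ d ∧
            Metric.closedBall x (2 * r) ⊆ ⋃ y ∈ (F : Set X), Metric.closedBall y r) →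
        ∀ ε : ℝ, 0 < ε → ε < 1 →
          ∃ S : Finset (Sym2 X), IsEdgeSetOn (Finset.univ : Finset X) S ∧
            (∀ x y : X, pathDist S x y ≤ ENNReal.ofReal ((1 + ε) * dist x y)) ∧
            edgeWeight S ≤
              C * ε⁻¹ ^ (d + 2) * Real.log (2 + ε⁻¹) * mstw (Finset.univ : Finset X) := by
  exact spanner_final d
end

section
/- For every natural number d ≥ 1 there exists a constant C > 0 (depending only on d) with the following property. For every ε ∈ (0, 1), every real ℓ > 0, and every nonempty finite set T of points of the d-dimensional Euclidean space (EuclideanSpace ℝ (Fin d)), there exists an edge set E on T with |E| ≤ C · ε^{-(d−1)} · |T| such that for all distinct x, y ∈ T with ℓ/8 ≤ ‖x − y‖ ≤ ℓ one has d_E(x, y) ≤ (1 + ε) · ‖x − y‖. -/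
open scoped ENNReal BigOperators

universe u

theorem spanner_of_coloring {V : Type} [NormedAddCommGroup V] [NormedSpace ℝ V]
    {K : Type} [Fintype K] (ε : ℝ) (h0 : 0 < ε) (h1 : ε < 1)
    (c : V → K) (s : V → ℝ) (hs : ∀ v, v ≠ 0 → 0 < s v) (hsn : ∀ v, s v ≤ ‖v‖)
    (hc : ∀ v v', v ≠ 0 → v' ≠ 0 → c v = c v' →
      ‖(s v')⁻¹ • v' - (s v)⁻¹ • v‖ ≤ ε / 3)
    {X : Type} [MetricSpace X] (T : Finset X) (ι : X → V)
    (hι : ∀ x y, dist x y = ‖ι y - ι x‖) :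
    ∃ E : Finset (Sym2 X), IsEdgeSetOn T E ∧ E.card ≤ T.card * Fintype.card K ∧
      ∀ x ∈ T, ∀ y ∈ T, ∃ l, IsPathIn E x y l ∧ pathLength x l ≤ (1 + ε) * dist x y := by
  classical
  have hf : ∀ (x : X) (k : K), ∃ z : X, (x ∈ T → z ∈ T) ∧
      ∀ y ∈ T, y ≠ x → c (ι y - ι x) = k →
        z ≠ x ∧ c (ι z - ι x) = k ∧ s (ι z - ι x) ≤ s (ι y - ι x) := by
    intro x k
    by_cases hA : (T.filter (fun y => y ≠ x ∧ c (ι y - ι x) = k)).Nonempty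
    · obtain ⟨z, hz, hmin⟩ := Finset.exists_min_image _ (fun y => s (ι y - ι x)) hA
      rw [Finset.mem_filter] at hz
      refine ⟨z, fun _ => hz.1, fun y hy hyx hk => ⟨hz.2.1, hz.2.2, hmin y ?_⟩⟩
      rw [Finset.mem_filter]
      exact ⟨hy, hyx, hk⟩
    · refine ⟨x, fun h => h, fun y hy hyx hk => absurd ⟨y, ?_⟩ hA⟩
      rw [Finset.mem_filter]
      exact ⟨hy, hyx, hk⟩
  choose f hfT hf using hf
  let E : Finset (Sym2 X) :=
    ((T ×ˢ (Finset.univ : Finset K)).image (fun p => s(p.1, f p.1 p.2))).filter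
      (fun e => ¬ e.IsDiag)
  refine ⟨E, ?_, ?_, ?_⟩
  · intro e he
    simp only [E, Finset.mem_filter, Finset.mem_image, Finset.mem_product] at he
    obtain ⟨⟨⟨x, k⟩, ⟨hx, -⟩, rfl⟩, hd⟩ := he
    refine ⟨hd, fun y hy => ?_⟩
    rcases Sym2.mem_iff.1 hy with rfl | rfl
    · exact hx
    · exact hfT _ _ hx
  · refine (Finset.card_filter_le _ _).trans (Finset.card_image_le.trans ?_)
    rw [Finset.card_product, Finset.card_univ]
  · by_contra hcon
    push Not at hcon
    let B := (T ×ˢ T).filter (fun p => ∀ l, IsPathIn E p.1 p.2 l →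
      (1 + ε) * dist p.1 p.2 < pathLength p.1 l)
    have hB : B.Nonempty := by
      obtain ⟨x, hx, y, hy, h⟩ := hcon
      exact ⟨(x, y), by simp only [B, Finset.mem_filter, Finset.mem_product]; exact ⟨⟨hx, hy⟩, h⟩⟩
    obtain ⟨⟨x, y⟩, hp, hmin⟩ := Finset.exists_min_image B (fun p => dist p.1 p.2) hB
    simp only [B, Finset.mem_filter, Finset.mem_product] at hp
    obtain ⟨⟨hx, hy⟩, hbad⟩ := hp
    by_cases hxy : y = x
    · subst hxy
      have := hbad [] ⟨List.IsChain.singleton _, by simp⟩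
      simp [pathLength] at this
    obtain ⟨hzx, hck, hsz⟩ := hf x (c (ι y - ι x)) y hy hxy rfl
    have hzT := hfT x (c (ι y - ι x)) hx
    set z := f x (c (ι y - ι x)) with hz
    have hne : ∀ t, t ≠ x → ι t - ι x ≠ 0 := by
      intro t ht h
      apply ht
      have := hι x t
      rw [h, norm_zero] at this
      exact (dist_eq_zero.1 this).symm
    have hedge : s(x, z) ∈ E := by
      simp only [E, Finset.mem_filter, Finset.mem_image, Finset.mem_product]
      exact ⟨⟨(x, c (ι y - ι x)), ⟨hx, Finset.mem_univ _⟩, rfl⟩, by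
        simpa using fun h => hzx h.symm⟩
    -- geometry
    have ha := hs _ (hne z hzx)
    have hb := hs _ (hne y hxy)
    have hw := hc _ _ (hne z hzx) (hne y hxy) hck
    have hbn := hsn (ι y - ι x)
    have e1 := hι x z
    have e2 := hι x y
    have e3 : dist z y = ‖(ι y - ι x) - (ι z - ι x)‖ := by rw [hι]; congr 1; abel
    generalize ι z - ι x = v at *
    generalize ι y - ι x = v' at *
    set a := s v
    set b := s v'
    set w := a⁻¹ • v with hwd
    set w' := b⁻¹ • v' with hwd'
    have hv : v = a • w := by rw [hwd, smul_smul, mul_inv_cancel₀ ha.ne', one_smul]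
    have hv' : v' = b • w' := by rw [hwd', smul_smul, mul_inv_cancel₀ hb.ne', one_smul]
    have n1 : ‖v‖ = a * ‖w‖ := by
      conv_lhs => rw [hv]
      rw [norm_smul, Real.norm_of_nonneg ha.le]
    have n2 : ‖v'‖ = b * ‖w'‖ := by
      conv_lhs => rw [hv']
      rw [norm_smul, Real.norm_of_nonneg hb.le]
    have hw1 : 1 ≤ ‖w'‖ := by
      rw [n2] at hbn
      by_contra hlt
      push Not at hlt
      nlinarith
    have hww : ‖w‖ ≤ ‖w'‖ + ε / 3 := by
      have : ‖w‖ ≤ ‖w'‖ + ‖w' - w‖ := norm_le_norm_add_norm_sub _ _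
      linarith
    clear_value w w'
    have n3 : ‖v' - v‖ ≤ (b - a) * ‖w'‖ + a * (ε / 3) := by
      have : v' - v = (b - a) • w' + a • (w' - w) := by
        conv_lhs => rw [hv, hv']
        module
      rw [this]
      refine (norm_add_le _ _).trans ?_
      rw [norm_smul, norm_smul, Real.norm_of_nonneg ha.le,
        Real.norm_of_nonneg (sub_nonneg.2 hsz)]
      gcongr
    have hlt : dist z y < dist x y := by
      rw [e3, e2, n2]
      nlinarith
    have hzy : ∃ l, IsPathIn E z y l ∧ pathLength z l ≤ (1 + ε) * dist z y := by
      by_contra hno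
      push Not at hno
      have := hmin (z, y) (by
        simp only [B, Finset.mem_filter, Finset.mem_product]; exact ⟨⟨hzT, hy⟩, hno⟩)
      simp only at this
      linarith
    obtain ⟨l, ⟨hl1, hl2⟩, hl3⟩ := hzy
    have := hbad (z :: l) ⟨by
      unfold List.Chain at hl1 ⊢
      exact List.IsChain.cons_cons hedge hl1, by
      simpa using hl2⟩
    simp only [pathLength] at this
    have key : dist x z + (1 + ε) * dist z y ≤ (1 + ε) * dist x y := by
      rw [e1, e2, e3, n1, n2]
      have p1 : a * ‖w‖ ≤ a * (‖w'‖ + ε / 3) := by gcongr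
      have p2 : (1 + ε) * ‖v' - v‖ ≤ (1 + ε) * ((b - a) * ‖w'‖ + a * (ε / 3)) := by gcongr
      have p3 : 0 ≤ a * (ε * (‖w'‖ - 1)) := by
        have : 0 ≤ ‖w'‖ - 1 := by linarith
        positivity
      have p4 : 0 ≤ a * (ε * (1 - ε)) := by
        have : 0 ≤ 1 - ε := by linarith
        positivity
      nlinarith
    linarith

theorem exists_coloring (n : ℕ) (ε : ℝ) (h0 : 0 < ε) (h1 : ε < 1) :
    ∃ (N : ℕ) (c : EuclideanSpace ℝ (Fin (n + 1)) → Fin (n + 1) × Bool × (Fin n → Fin N))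
      (s : EuclideanSpace ℝ (Fin (n + 1)) → ℝ),
      (N : ℝ) ≤ 9 * (n + 1) * ε⁻¹ ∧ (∀ v, v ≠ 0 → 0 < s v) ∧ (∀ v, s v ≤ ‖v‖) ∧
      (∀ v v', v ≠ 0 → v' ≠ 0 → c v = c v' →
        ‖(s v')⁻¹ • v' - (s v)⁻¹ • v‖ ≤ ε / 3) := by
  have hm : ∀ v : EuclideanSpace ℝ (Fin (n + 1)), ∃ i, ∀ j, |v j| ≤ |v i| :=
    fun v => Finite.exists_max (fun j => |v j|)
  choose m hm using hm
  set η : ℝ := ε / (3 * (n + 1)) with hη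
  have hηpos : 0 < η := by positivity
  have hη1 : η ≤ 1 := by
    rw [hη, div_le_one (by positivity)]
    have : (0 : ℝ) ≤ n := Nat.cast_nonneg n
    linarith
  let s : EuclideanSpace ℝ (Fin (n + 1)) → ℝ := fun v => |v (m v)|
  have hs : ∀ v, v ≠ 0 → 0 < s v := by
    intro v hv
    by_contra hle
    push Not at hle
    apply hv
    ext j
    have := (hm v j).trans hle
    simpa using abs_eq_zero.1 (le_antisymm this (abs_nonneg _))
  have hb : ∀ v, v ≠ 0 → ∀ j, |(s v)⁻¹ * v j| ≤ 1 := by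
    intro v hv j
    rw [abs_mul, abs_inv, abs_of_pos (hs v hv), inv_mul_le_one₀ (hs v hv)]
    exact hm v j
  let g : EuclideanSpace ℝ (Fin (n + 1)) → Fin (n + 1) → ℕ :=
    fun v j => ⌊((s v)⁻¹ * v j + 1) / η⌋₊
  let c : EuclideanSpace ℝ (Fin (n + 1)) →
      Fin (n + 1) × Bool × (Fin n → Fin (⌊2 / η⌋₊ + 1)) :=
    fun v => (m v, decide (0 < v (m v)), fun j => Fin.ofNat _ (g v ((m v).succAbove j)))
  refine ⟨⌊2 / η⌋₊ + 1, c, s, ?_, hs, ?_, ?_⟩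
  · push_cast
    have h2 : (⌊2 / η⌋₊ : ℝ) ≤ 2 / η := Nat.floor_le (by positivity)
    have h3 : (1 : ℝ) ≤ 1 / η := by rw [le_div_iff₀ hηpos]; linarith
    have h4 : 9 * ((n : ℝ) + 1) * ε⁻¹ = 2 / η + 1 / η := by
      rw [hη]; field_simp; norm_num
    linarith
  · intro v
    have := PiLp.norm_apply_le v (m v)
    simpa [s] using this
  · intro v v' hv hv' hcc
    simp only [c, Prod.mk.injEq] at hcc
    obtain ⟨hi, hsg, hfl⟩ := hcc
    have hgN : ∀ u, u ≠ 0 → ∀ j, g u j < ⌊2 / η⌋₊ + 1 := by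
      intro u hu j
      apply Nat.lt_succ_of_le
      apply Nat.floor_mono
      have := (abs_le.1 (hb u hu j)).2
      gcongr
      linarith
    have hco : ∀ j, |(s v')⁻¹ * v' j - (s v)⁻¹ * v j| ≤ η := by
      intro j
      rcases Fin.eq_self_or_eq_succAbove (m v) j with rfl | ⟨k, rfl⟩
      · have hv1 := hs v hv
        have hv1' := hs v' hv'
        rw [← hi] at hsg
        have e1 : s v = |v (m v)| := rfl
        have e2 : s v' = |v' (m v)| := by rw [hi]
        rw [e1] at hv1 ⊢
        rw [e2] at hv1' ⊢
        have n1 := abs_pos.1 hv1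
        have n1' := abs_pos.1 hv1'
        have : |v' (m v)|⁻¹ * v' (m v) = |v (m v)|⁻¹ * v (m v) := by
          by_cases hp : 0 < v (m v)
          · have hp' : 0 < v' (m v) := by simpa [hp] using hsg
            rw [abs_of_pos hp, abs_of_pos hp', inv_mul_cancel₀ n1, inv_mul_cancel₀ n1']
          · have hp' : ¬ 0 < v' (m v) := by simpa [hp] using hsg
            push Not at hp hp'
            rw [abs_of_nonpos hp, abs_of_nonpos hp', inv_neg, inv_neg, neg_mul, neg_mul,
              inv_mul_cancel₀ n1, inv_mul_cancel₀ n1']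
        rw [this, sub_self, abs_zero]
        exact hηpos.le
      · have hk := congrFun hfl k
        rw [← hi] at hk
        have hk' := congrArg Fin.val hk
        simp only [Fin.val_ofNat] at hk'
        rw [Nat.mod_eq_of_lt (hgN v hv _), Nat.mod_eq_of_lt (hgN v' hv' _)] at hk'
        simp only [g] at hk'
        have q := abs_le.1 (hb v hv ((m v).succAbove k))
        have q' := abs_le.1 (hb v' hv' ((m v).succAbove k))
        generalize (s v)⁻¹ * v ((m v).succAbove k) = A at *
        generalize (s v')⁻¹ * v' ((m v).succAbove k) = A' at *
        have f1 := Nat.floor_le (a := (A + 1) / η) (div_nonneg (by linarith) hηpos.le)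
        have f2 := Nat.lt_floor_add_one ((A + 1) / η)
        have f1' := Nat.floor_le (a := (A' + 1) / η) (div_nonneg (by linarith) hηpos.le)
        have f2' := Nat.lt_floor_add_one ((A' + 1) / η)
        rw [← hk'] at f1' f2'
        have r : |(A' + 1) / η - (A + 1) / η| ≤ 1 := by
          rw [abs_le]; constructor <;> linarith
        have : A' - A = ((A' + 1) / η - (A + 1) / η) * η := by field_simp; ring
        rw [this, abs_mul, abs_of_pos hηpos]
        nlinarith
    have hnorm : ∀ u : EuclideanSpace ℝ (Fin (n + 1)), (∀ j, |u j| ≤ η) →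
        ‖u‖ ≤ (n + 1) * η := by
      intro u hu
      rw [EuclideanSpace.norm_eq]
      apply Real.sqrt_le_iff.2
      refine ⟨by positivity, ?_⟩
      calc ∑ i, ‖u i‖ ^ 2 ≤ ∑ i : Fin (n + 1), η ^ 2 := by
            apply Finset.sum_le_sum
            intro i _
            have := hu i
            rw [Real.norm_eq_abs]
            gcongr
        _ = (n + 1) * η ^ 2 := by simp
        _ ≤ ((n + 1) * η) ^ 2 := by
            have : (0 : ℝ) ≤ n := Nat.cast_nonneg n
            rw [mul_pow]
            gcongr
            nlinarith
    have := hnorm ((s v')⁻¹ • v' - (s v)⁻¹ • v) (by simpa using hco)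
    refine this.trans (le_of_eq ?_)
    rw [hη]; field_simp

/-- Lemma 13: Euclidean point sets have a (1+ε)-spanner oracle with strong sparsity
O(ε^{1-d}). -/
theorem euclidean_sparse_spanner_oracle (d : ℕ) (hd : 1 ≤ d) :
    ∃ C : ℝ, 0 < C ∧
      ∀ ε : ℝ, 0 < ε → ε < 1 → ∀ ℓ : ℝ, 0 < ℓ →
        ∀ T : Finset (EuclideanSpace ℝ (Fin d)), T.Nonempty →
          ∃ E : Finset (Sym2 (EuclideanSpace ℝ (Fin d))), IsEdgeSetOn T E ∧
            (E.card : ℝ) ≤ C * ε⁻¹ ^ (d - 1) * T.card ∧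
            ∀ x ∈ T, ∀ y ∈ T, x ≠ y → ℓ / 8 ≤ ‖x - y‖ → ‖x - y‖ ≤ ℓ →
              pathDist E x y ≤ ENNReal.ofReal ((1 + ε) * ‖x - y‖) := by
  obtain ⟨n, rfl⟩ : ∃ n, d = n + 1 := ⟨d - 1, by omega⟩
  refine ⟨2 * (n + 1) * (9 * (n + 1)) ^ n, by positivity, ?_⟩
  intro ε h0 h1 ℓ _ T _
  obtain ⟨N, c, s, hN, hs, hsn, hc⟩ := exists_coloring n ε h0 h1
  obtain ⟨E, hE, hcard, hp⟩ := spanner_of_coloring ε h0 h1 c s hs hsn hc T id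
    (fun x y => by rw [dist_comm, dist_eq_norm]; rfl)
  refine ⟨E, hE, ?_, ?_⟩
  · have h2 : (E.card : ℝ) ≤ T.card * ((n + 1) * (2 * (N : ℝ) ^ n)) := by
      have : E.card ≤ T.card * ((n + 1) * (2 * N ^ n)) := by simpa using hcard
      exact_mod_cast this
    have h3 : (N : ℝ) ^ n ≤ (9 * (n + 1)) ^ n * ε⁻¹ ^ n := by
      rw [← mul_pow]
      gcongr
    rw [Nat.add_sub_cancel]
    calc (E.card : ℝ) ≤ T.card * ((n + 1) * (2 * (N : ℝ) ^ n)) := h2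
      _ ≤ T.card * ((n + 1) * (2 * ((9 * (n + 1)) ^ n * ε⁻¹ ^ n))) := by gcongr
      _ = _ := by ring
  · intro x hx y hy _ _ _
    obtain ⟨l, hl, hlen⟩ := hp x hx y hy
    rw [← dist_eq_norm]
    exact (iInf₂_le l hl).trans (ENNReal.ofReal_le_ofReal hlen)
end
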